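/- For every n ≥ 3, the dynamical Lie algebra ℒ of the periodic Ising chain is the internal direct sum of real subspaces ℒ = 𝒞 ⊕ ⨁_{λ̄} I_λ̄, where 𝒞 is the two-dimensional center of ℒ and the sum runs over the n−1 distinct real roots λ̄ of the polynomial a_{n−1}; each summand I_λ̄ = span_ℝ{X̂_λ̄, Ŷ_λ̄, Ẑ_λ̄} is a three-dimensional Lie ideal of ℒ isomorphic as a real Lie algebra to su(2). -/

import Mathlib

namespace Ising

noncomputable section

open Matrix

attribute [local instance 100] LieRing.ofAssociativeRing

/-- We model `2^n × 2^n` complex matrices as matrices indexed by `Fin n → Fin 2`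
(the standard index type for an `n`-fold tensor product of qubits). -/
abbrev M (n : ℕ) := Matrix (Fin n → Fin 2) (Fin n → Fin 2) ℂ

/-- The Pauli matrix σx. -/
def sx : Matrix (Fin 2) (Fin 2) ℂ := !![0, 1; 1, 0]
/-- The Pauli matrix σy. -/
def sy : Matrix (Fin 2) (Fin 2) ℂ := !![0, Complex.I; -Complex.I, 0]
/-- The Pauli matrix σz. -/
def sz : Matrix (Fin 2) (Fin 2) ℂ := !![1, 0; 0, -1]

/-- The `n`-fold Kronecker product of the `2 × 2` matrices `f 0, …, f (n-1)`. -/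
def kron {n : ℕ} (f : Fin n → Matrix (Fin 2) (Fin 2) ℂ) : M n :=
  fun x y => ∏ j, f j (x j) (y j)

/-- The matrix `σ` placed in the `j`-th tensor factor, identity elsewhere (`σ^j`). -/
def pauliAt (n : ℕ) (σ : Matrix (Fin 2) (Fin 2) ℂ) (j : Fin n) : M n :=
  kron fun i => if i = j then σ else 1

/-- The permutation matrix implementing the cyclic shift of the `n` tensor factors. -/
def P (n : ℕ) : M n :=
  fun x y => if x = (fun i => y (finRotate n i)) then 1 else 0

/-- The symmetrizer `C(A) = ∑_{k=0}^{n-1} Pᵏ A (Pᵏ)⁻¹` over the cyclic group `C_n`. -/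
def symmC {n : ℕ} (A : M n) : M n :=
  ∑ k ∈ Finset.range n, P n ^ k * A * (P n ^ k)⁻¹

/-- The Pauli string `a ⊗ σx^{⊗j} ⊗ b ⊗ 1^{⊗(n-j-2)}`. -/
def str (n : ℕ) (a b : Matrix (Fin 2) (Fin 2) ℂ) (j : ℕ) : M n :=
  kron fun i => if (i : ℕ) = 0 then a else if (i : ℕ) = j + 1 then b
    else if (i : ℕ) ≤ j then sx else 1

/-- `Y^j := i C(σy ⊗ σx^{⊗j} ⊗ σy ⊗ 1^{⊗(n-j-2)})`. -/
def Y (n j : ℕ) : M n := Complex.I • symmC (str n sy sy j)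
/-- `Z^j := i C(σz ⊗ σx^{⊗j} ⊗ σz ⊗ 1^{⊗(n-j-2)})`. -/
def Z (n j : ℕ) : M n := Complex.I • symmC (str n sz sz j)
/-- `YZ^j := i C(σz ⊗ σx^{⊗j} ⊗ σy ⊗ 1^{⊗(n-j-2)}) + i C(σy ⊗ σx^{⊗j} ⊗ σz ⊗ 1^{⊗(n-j-2)})`. -/
def YZ (n j : ℕ) : M n :=
  Complex.I • symmC (str n sz sy j) + Complex.I • symmC (str n sy sz j)
/-- `X := i C(σx ⊗ 1^{⊗(n-1)})`. -/
def X (n : ℕ) : M n :=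
  Complex.I • symmC (kron fun i : Fin n => if (i : ℕ) = 0 then sx else 1)
/-- `XX := i C(σx^{⊗(n-1)} ⊗ 1)`. -/
def XX (n : ℕ) : M n :=
  Complex.I • symmC (kron fun i : Fin n => if (i : ℕ) = n - 1 then 1 else sx)

/-- `H0 = ∑_{j=1}^{n-1} σz^j σz^{j+1} + σz^n σz^1` (cyclically next neighbours). -/
def H0 (n : ℕ) : M n := ∑ j : Fin n, pauliAt n sz j * pauliAt n sz (finRotate n j)
/-- `H1 = ∑_{j=1}^{n} σx^j`. -/
def H1 (n : ℕ) : M n := ∑ j : Fin n, pauliAt n sx j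

/-- The dynamical Lie algebra: the smallest real Lie subalgebra of the `2^n × 2^n`
complex matrices (with the commutator bracket) containing `i•H0` and `i•H1`. -/
def DLA (n : ℕ) : LieSubalgebra ℝ (M n) :=
  LieSubalgebra.lieSpan ℝ (M n) {Complex.I • H0 n, Complex.I • H1 n}

/-- The polynomials `a_k(λ)`, defined by `a₋₁ = 0`, `a₀ = 1`, `a_k = λ a_{k-1} - a_{k-2}`
(so `a 1 = λ·a₀ - a₋₁ = λ`). -/
def aSeq (lam : ℝ) : ℕ → ℝ
  | 0 => 1
  | 1 => lam
  | k + 2 => lam * aSeq lam (k + 1) - aSeq lam k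

/-- `X̂ = a₀(X + Z¹) + a_{n-2}(λ̄)(XX - Y^{n-3}) + ∑_{k=1}^{n-3} a_k(λ̄)(Z^{k+1} - Y^{k-1})`. -/
def Xhat (n : ℕ) (lam : ℝ) : M n :=
  (X n + Z n 1) + aSeq lam (n - 2) • (XX n - Y n (n - 3)) +
    ∑ k ∈ Finset.Icc 1 (n - 3), aSeq lam k • (Z n (k + 1) - Y n (k - 1))

/-- `Ŷ = ∑_{k=0}^{n-2} a_k(λ̄)(Y^k - Z^k)`. -/
def Yhat (n : ℕ) (lam : ℝ) : M n :=
  ∑ k ∈ Finset.range (n - 1), aSeq lam k • (Y n k - Z n k)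

/-- `Ẑ = ∑_{k=0}^{n-2} a_k(λ̄) YZ^k`. -/
def Zhat (n : ℕ) (lam : ℝ) : M n :=
  ∑ k ∈ Finset.range (n - 1), aSeq lam k • YZ n k

/-- `I_λ̄ = span_ℝ {X̂, Ŷ, Ẑ}`. -/
def Ideal (n : ℕ) (lam : ℝ) : Submodule ℝ (M n) :=
  Submodule.span ℝ {Xhat n lam, Yhat n lam, Zhat n lam}

/-- The center of the dynamical Lie algebra, as a real subspace of the matrices:
the elements of `ℒ` commuting with all of `ℒ`. -/
def centerSub (n : ℕ) : Submodule ℝ (M n) where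
  carrier := {A | A ∈ DLA n ∧ ∀ B ∈ DLA n, ⁅A, B⁆ = 0}
  zero_mem' := ⟨(DLA n).zero_mem, fun B _ => zero_lie B⟩
  add_mem' := fun hx hy => ⟨(DLA n).add_mem hx.1 hy.1,
    fun B hB => by rw [add_lie, hx.2 B hB, hy.2 B hB, add_zero]⟩
  smul_mem' := fun r x hx => ⟨(DLA n).smul_mem r hx.1,
    fun B hB => by rw [smul_lie, hx.2 B hB, smul_zero]⟩

/-- The family of subspaces appearing in the direct sum decomposition of `ℒ`:
the center, together with one subspace `I_λ̄` for each real root `λ̄` of `a_{n-1}`. -/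
def fam16 (n : ℕ) : Option {lam : ℝ // aSeq lam (n - 1) = 0} → Submodule ℝ (M n)
  | none => centerSub n
  | some lam => Ideal n lam.1

structure Ons {L : Type*} [LieRing L] [LieAlgebra ℝ L] (n : ℕ) (A G : ℤ → L) : Prop where
  h0 : ∀ m, ⁅A 0, A m⁆ = (2:ℝ) • G m
  h1 : ∀ m, ⁅A 1, A m⁆ = (2:ℝ) • G (m - 1)
  h2 : ∀ m, ⁅A 0, G m⁆ = (-4:ℝ) • (A m - A (-m))
  h3 : ∀ m, ⁅A 1, G m⁆ = (-4:ℝ) • (A (1 + m) - A (1 - m))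
  odd : ∀ m, G (-m) = - G m
  gl0 : A n = A (-n)
  gl1 : A (n + 1) = A (1 - n)

namespace Ons
variable {L : Type*} [LieRing L] [LieAlgebra ℝ L] {n : ℕ} {A G : ℤ → L}

lemma two_ind {p : ℤ → Prop} (a : ℤ) (h0 : p a) (h1 : p (a+1)) (hu : ∀ m, p (m-1) → p m → p (m+1))
    (hd : ∀ m, p m → p (m+1) → p (m-1)) : ∀ m, p m := by
  have key : ∀ m, p m ∧ p (m+1) := by
    intro m
    induction m using Int.inductionOn' (b := a) with
    | zero => exact ⟨h0, h1⟩
    | succ k _ ih => exact ⟨ih.2, hu _ (by simpa using ih.1) ih.2⟩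
    | pred k _ ih => exact ⟨hd _ ih.1 ih.2, by simpa using ih.1⟩
  exact fun m => (key m).1

lemma g1A (h : Ons n A G) (m : ℤ) : ⁅G 1, A m⁆ = (4:ℝ) • (A (m+1) - A (m-1)) := by
  have e1 : G 1 = (1/2:ℝ) • ⁅A 0, A 1⁆ := by rw [h.h0]; module
  rw [e1, smul_lie, lie_lie, h.h1, h.h0, lie_smul, lie_smul, h.h2, h.h3,
    show -(m-1) = 1 - m by ring, show 1 + m = m + 1 by ring]
  module

lemma g1G (h : Ons n A G) (m : ℤ) : ⁅G 1, G m⁆ = 0 := by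
  have e1 : G 1 = (1/2:ℝ) • ⁅A 0, A 1⁆ := by rw [h.h0]; module
  rw [e1, smul_lie, lie_lie, h.h2, h.h3, lie_smul, lie_smul, lie_sub, lie_sub, h.h0, h.h0, h.h1, h.h1,
    show 1 - m = -(m-1) by ring, h.odd, show -m - 1 = - (1+m) by ring, h.odd]
  module

lemma AA (h : Ons n A G) (l m : ℤ) : ⁅A l, A m⁆ = (-2:ℝ) • G (l - m) := by
  have step : ∀ l m, ⁅A (l+1), A m⁆ - ⁅A (l-1), A m⁆ + (⁅A l, A (m+1)⁆ - ⁅A l, A (m-1)⁆) =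
      (1/4:ℝ) • ⁅G 1, ⁅A l, A m⁆⁆ := by
    intro l m
    rw [leibniz_lie, h.g1A, h.g1A, smul_lie, lie_smul, sub_lie, lie_sub]
    module
  revert m
  refine two_ind (p := fun l => ∀ m, ⁅A l, A m⁆ = (-2:ℝ) • G (l - m)) 0 ?_ ?_ ?_ ?_ l
  · intro m; rw [h.h0, zero_sub, h.odd]; module
  · intro m; rw [zero_add, h.h1, show 1 - m = -(m-1) by ring, h.odd]; module
  · intro l ih1 ih2 m
    have := step l m
    rw [ih1, ih2, ih2, ih2, lie_smul, h.g1G, smul_zero, smul_zero,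
      show l - (m-1) = l + 1 - m by ring, show l - 1 - m = l - (m+1) by ring] at this
    linear_combination (norm := module) (1:ℝ) • this
  · intro l ih1 ih2 m
    have := step l m
    rw [ih2, ih1, ih1, ih1, lie_smul, h.g1G, smul_zero, smul_zero,
      show l - (m-1) = l + 1 - m by ring, show  l - (m+1) = l - 1 - m by ring] at this
    linear_combination (norm := module) (-1:ℝ) • this

lemma A0G (h : Ons n A G) (l : ℤ) : ⁅G l, A 0⁆ = (4:ℝ) • (A (0+l) - A (0-l)) := by
  rw [← lie_skew, h.h2, zero_add, zero_sub]; module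

lemma GA (h : Ons n A G) (l m : ℤ) : ⁅G l, A m⁆ = (4:ℝ) • (A (m+l) - A (m-l)) := by
  have hc : ∀ m, ⁅G l, A (m+1)⁆ - ⁅G l, A (m-1)⁆ = (1/4:ℝ) • ⁅G 1, ⁅G l, A m⁆⁆ := by
    intro m
    rw [leibniz_lie, h.g1G, zero_lie, zero_add, h.g1A, lie_smul, lie_sub]; module
  refine two_ind (p := fun m => ⁅G l, A m⁆ = (4:ℝ) • (A (m+l) - A (m-l))) 0 (h.A0G l) ?_ ?_ ?_ m
  · rw [← lie_skew, zero_add, h.h3]; module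
  · intro m i1 i2
    have := hc m
    rw [i1, i2, lie_smul, lie_sub, h.g1A, h.g1A, show m - 1 + l = m + l - 1 by ring,
      show m - 1 - l = m - l - 1 by ring] at this
    rw [show m + 1 + l = m + l + 1 by ring, show m + 1 - l = m - l + 1 by ring]
    linear_combination (norm := module) (1:ℝ) • this
  · intro m i1 i2
    have := hc m
    rw [i1, i2, lie_smul, lie_sub, h.g1A, h.g1A, show m + 1 + l = m + l + 1 by ring, show m + 1 - l = m - l + 1 by ring] at this
    rw [show m - 1 + l = m + l - 1 by ring,
      show m - 1 - l = m - l - 1 by ring]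
    linear_combination (norm := module) (-1:ℝ) • this

lemma perA (h : Ons n A G) (m : ℤ) : A (m + 2 * n) = A m := by
  have hs : ∀ m, A (m+1) - A (m-1) = (1/4:ℝ) • ⁅G 1, A m⁆ := by intro m; rw [h.g1A]; module
  refine two_ind (p := fun m => A (m + 2 * n) = A m) (-n) ?_ ?_ ?_ ?_ m
  · rw [← h.gl0]; congr 1; ring
  · rw [show -(n:ℤ) + 1 + 2 * n = n + 1 by ring, h.gl1]; congr 1; ring
  · intro m i1 i2
    have e1 := hs m
    have e2 := hs (m + 2 * n)
    rw [i2, show m + 2 * n - 1 = m - 1 + 2 * n by ring, i1] at e2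
    rw [show m + 1 + 2 * n = m + 2 * n + 1 by ring]
    linear_combination (norm := module) (1:ℝ) • e2 - (1:ℝ) • e1
  · intro m i1 i2
    have e1 := hs m
    have e2 := hs (m + 2 * n)
    rw [i1, show m + 2 * n + 1 = m + 1 + 2 * n by ring, i2] at e2
    rw [show m - 1 + 2 * n = m + 2 * n - 1 by ring]
    linear_combination (norm := module) (1:ℝ) • e1 - (1:ℝ) • e2

lemma perG (h : Ons n A G) (m : ℤ) : G (m + 2 * n) = G m := by
  have e1 := h.h0 m
  have e2 := h.h0 (m + 2 * n)
  rw [h.perA, e1] at e2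
  exact (smul_right_injective L (two_ne_zero (α := ℝ)) e2).symm
end Ons

noncomputable section

open Polynomial.Chebyshev in
lemma aSeq_eq (x : ℝ) : ∀ k : ℕ, aSeq (2 * x) k = (U ℝ k).eval x
  | 0 => by simp [aSeq]
  | 1 => by simp [aSeq]
  | k + 2 => by
    have := U_add_two ℝ k
    push_cast
    rw [this, aSeq, aSeq_eq x (k+1), aSeq_eq x k]
    simp

lemma aSeq_sin (t : ℝ) (k : ℕ) : aSeq (2 * Real.cos t) k * Real.sin t = Real.sin ((k + 1) * t) := by
  rw [aSeq_eq, Polynomial.Chebyshev.U_real_cos]; simp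

/-- the root `2 cos(j π / n)` -/
def rt (n : ℕ) (j : ℕ) : ℝ := 2 * Real.cos (j * Real.pi / n)

lemma root_iff (n : ℕ) (hn : 3 ≤ n) (lam : ℝ) :
    aSeq lam (n - 1) = 0 ↔ ∃ j : ℕ, 1 ≤ j ∧ j < n ∧ lam = rt n j := by
  have e : lam = 2 * (lam / 2) := by ring
  have h1 := Polynomial.Chebyshev.roots_U_real (n-1)
  have hne : Polynomial.Chebyshev.U ℝ ((n-1 : ℕ):ℤ) ≠ 0 :=
    Polynomial.Chebyshev.U_ne_zero _ _ (by omega)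
  have h2 : aSeq lam (n-1) = 0 ↔ lam / 2 ∈ (Polynomial.Chebyshev.U ℝ ((n-1 : ℕ):ℤ)).roots := by
    rw [Polynomial.mem_roots hne, Polynomial.IsRoot, ← aSeq_eq, ← e]
  rw [h2, h1, Finset.mem_val, Finset.mem_image]
  have c : ((n-1:ℕ):ℝ) + 1 = n := by rw [Nat.cast_sub (by omega)]; simp
  rw [c]
  constructor
  · rintro ⟨k, hk, h⟩
    rw [Finset.mem_range] at hk
    exact ⟨k+1, by omega, by omega, by rw [rt, e, ← h]; push_cast; rfl⟩
  · rintro ⟨j, h1, h2, h⟩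
    refine ⟨j-1, by rw [Finset.mem_range]; omega, ?_⟩
    rw [h, rt, Nat.cast_sub h1]; simp

lemma root_card (n : ℕ) (hn : 3 ≤ n) : {lam : ℝ | aSeq lam (n - 1) = 0}.ncard = n - 1 := by
  have h1 := Polynomial.Chebyshev.roots_U_real_nodup (n-1)
  have : {lam : ℝ | aSeq lam (n - 1) = 0} = ((Finset.Ico 1 n).image (rt n) : Finset ℝ) := by
    ext x
    simp only [Set.mem_ofPred_eq, root_iff n hn, Finset.coe_image, Set.mem_image, Finset.coe_Ico,
      Set.mem_Ico]
    constructor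
    · rintro ⟨j, a, b, c⟩; exact ⟨j, ⟨a, b⟩, c.symm⟩
    · rintro ⟨j, ⟨a, b⟩, c⟩; exact ⟨j, a, b, c.symm⟩
  rw [this, Set.ncard_coe_finset, Finset.card_image_of_injOn]
  · simp
  · intro j hj j' hj' h
    have hn0 : (0:ℝ) < n := by exact_mod_cast (by omega : 0 < n)
    have mem : ∀ j : ℕ, j < n → (j * Real.pi / n : ℝ) ∈ Set.Icc 0 Real.pi := by
      intro j hj
      refine ⟨by positivity, ?_⟩
      rw [div_le_iff₀ hn0, mul_comm]
      have : (j:ℝ) ≤ n := by exact_mod_cast hj.le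
      nlinarith [Real.pi_pos]
    simp only [Finset.coe_Ico, Set.mem_Ico] at hj hj'
    have h2 : Real.cos (j * Real.pi / n) = Real.cos (j' * Real.pi / n) := by
      simp only [rt] at h; linarith
    have h3 := Real.injOn_cos (mem j hj.2) (mem j' hj'.2) h2
    field_simp at h3
    exact_mod_cast h3

/-! sums -/
lemma sum_shift {V : Type*} [AddCommGroup V] (N : ℕ) (f : ℤ → V) (hf : ∀ k, f (k + N) = f k) (m : ℤ) :
    ∑ k ∈ Finset.range N, f (k + m) = ∑ k ∈ Finset.range N, f k := by
  have step : ∀ g : ℤ → V, (∀ k, g (k + N) = g k) →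
      ∑ k ∈ Finset.range N, g (k + 1) = ∑ k ∈ Finset.range N, g k := by
    intro g hg
    have h1 := Finset.sum_range_succ (fun k : ℕ => g k) N
    have h2 := Finset.sum_range_succ' (fun k : ℕ => g k) N
    rw [h1] at h2
    have := hg 0
    push_cast at h2
    rw [zero_add] at this
    rw [this] at h2
    exact (add_right_cancel h2).symm
  induction m using Int.induction_on with
  | zero => simp
  | succ i ih =>
    rw [← ih, ← step (fun k => f (k + i)) (fun k => by rw [← hf (k + i)]; congr 1; ring)]
    refine Finset.sum_congr rfl fun k _ => ?_
    congr 1; ring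
  | pred i ih =>
    rw [← ih, ← step (fun k => f (k + (-i-1))) (fun k => by rw [← hf (k + (-i-1))]; congr 1; ring)]
    refine Finset.sum_congr rfl fun k _ => ?_
    congr 1; ring

lemma sum_neg' {V : Type*} [AddCommGroup V] (N : ℕ) (f : ℤ → V) (hf : ∀ k, f (k + N) = f k) :
    ∑ k ∈ Finset.range N, f (-k) = ∑ k ∈ Finset.range N, f k := by
  rw [← Finset.sum_range_reflect (fun k : ℕ => f (-k)),
    ← sum_shift N f hf (-N + 1)]
  refine Finset.sum_congr rfl fun k hk => ?_
  rw [Finset.mem_range] at hk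
  congr 1
  rw [Nat.cast_sub (by omega), Nat.cast_sub (by omega)]
  push_cast; ring

lemma sum_refl {V : Type*} [AddCommGroup V] (N : ℕ) (f : ℤ → V) (hf : ∀ k, f (k + N) = f k) (m : ℤ) :
    ∑ k ∈ Finset.range N, f (m - k) = ∑ k ∈ Finset.range N, f k := by
  rw [← sum_shift N f hf m, ← sum_neg' N (fun k => f (k + m))]
  · refine Finset.sum_congr rfl fun k _ => ?_
    congr 1; ring
  · intro k; rw [← hf (k+m)]; congr 1; ring

lemma exp_sum (n : ℕ) (hn : 0 < n) (t : ℤ) (ht : ¬ ((2 * n : ℤ) ∣ t)) :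
    ∑ k ∈ Finset.range (2 * n), Complex.exp (((k * (t * Real.pi / n) : ℝ) : ℂ) * Complex.I) = 0 := by
  set z := Complex.exp (((t * Real.pi / n : ℝ) : ℂ) * Complex.I) with hz
  have e : ∀ k : ℕ, Complex.exp (((k * (t * Real.pi / n) : ℝ) : ℂ) * Complex.I) = z ^ k := by
    intro k; rw [hz, ← Complex.exp_nat_mul]; congr 1; push_cast; ring
  have hn' : (n:ℂ) ≠ 0 := by exact_mod_cast hn.ne'
  have hpi : (Real.pi : ℂ) ≠ 0 := by exact_mod_cast Real.pi_ne_zero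
  simp only [e]
  have h1 : z ^ (2 * n) = 1 := by
    rw [hz, ← Complex.exp_nat_mul, Complex.exp_eq_one_iff]
    refine ⟨t, ?_⟩
    push_cast; field_simp
  have h2 : z ≠ 1 := by
    rw [hz, Ne, Complex.exp_eq_one_iff]
    rintro ⟨m, hm⟩
    apply ht
    refine ⟨m, ?_⟩
    push_cast at hm
    have hI := Complex.I_ne_zero
    field_simp at hm
    have : (t:ℂ) = ((2 * n * m : ℤ) : ℂ) := by push_cast; linear_combination hm
    exact_mod_cast this
  have := mul_geom_sum z (2 * n)
  rw [h1, sub_self] at this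
  exact (mul_eq_zero.mp this).resolve_left (sub_ne_zero.mpr h2)

lemma cos_sum (n : ℕ) (hn : 0 < n) (t : ℤ) (ht : ¬ ((2 * n : ℤ) ∣ t)) :
    ∑ k ∈ Finset.range (2 * n), Real.cos (k * (t * Real.pi / n)) = 0 := by
  have := congrArg Complex.re (exp_sum n hn t ht)
  simpa only [Complex.re_sum, Complex.exp_ofReal_mul_I_re, Complex.zero_re] using this

lemma sin_sum (n : ℕ) (hn : 0 < n) (t : ℤ) (ht : ¬ ((2 * n : ℤ) ∣ t)) :
    ∑ k ∈ Finset.range (2 * n), Real.sin (k * (t * Real.pi / n)) = 0 := by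
  have := congrArg Complex.im (exp_sum n hn t ht)
  simpa only [Complex.im_sum, Complex.exp_ofReal_mul_I_im, Complex.zero_im] using this
end
noncomputable section
namespace Ons
variable {L : Type*} [LieRing L] [LieAlgebra ℝ L] {n : ℕ} {A G : ℤ → L}

/-- the angle `t π / n` -/
def th (n : ℕ) (t : ℤ) : ℝ := t * Real.pi / n

lemma cos_per (hn : 0 < n) (t k : ℤ) : Real.cos (((k + (2 * n : ℕ) : ℤ) : ℝ) * th n t) = Real.cos (k * th n t) := by
  have hn' : (n:ℝ) ≠ 0 := by exact_mod_cast hn.ne'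
  rw [← Real.cos_add_int_mul_two_pi (k * th n t) t]
  congr 1; unfold th; push_cast; field_simp

lemma sin_per (hn : 0 < n) (t k : ℤ) : Real.sin (((k + (2 * n : ℕ) : ℤ) : ℝ) * th n t) = Real.sin (k * th n t) := by
  have hn' : (n:ℝ) ≠ 0 := by exact_mod_cast hn.ne'
  rw [← Real.sin_add_int_mul_two_pi (k * th n t) t]
  congr 1; unfold th; push_cast; field_simp

def cS (n : ℕ) (A : ℤ → L) (t : ℤ) : L := ∑ k ∈ Finset.range (2 * n), Real.cos ((k:ℤ) * th n t) • A k
def sS (n : ℕ) (A : ℤ → L) (t : ℤ) : L := ∑ k ∈ Finset.range (2 * n), Real.sin ((k:ℤ) * th n t) • A k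

lemma perA' (h : Ons n A G) (m : ℤ) : A (m + (2 * n : ℕ)) = A m := by
  have := h.perA m; push_cast; exact this
lemma perG' (h : Ons n A G) (m : ℤ) : G (m + (2 * n : ℕ)) = G m := by
  have := h.perG m; push_cast; exact this

/-- shift formulas for a periodic family -/
lemma sum_cos_shift (hn : 0 < n) (F : ℤ → L) (hF : ∀ m : ℤ, F (m + (2 * n : ℕ)) = F m) (t m : ℤ) :
    ∑ k ∈ Finset.range (2 * n), Real.cos ((k:ℤ) * th n t) • F (m - k) =
      Real.cos (m * th n t) • cS n F t + Real.sin (m * th n t) • sS n F t := by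
  have h1 := sum_refl (2 * n) (fun k : ℤ => Real.cos ((m - k : ℤ) * th n t) • F k) (by
    intro k
    rw [hF, ← cos_per hn t (m - (k + (2 * n : ℕ)))]
    congr 4; ring) m
  simp only [sub_sub_cancel] at h1
  rw [h1, cS, sS, Finset.smul_sum, Finset.smul_sum, ← Finset.sum_add_distrib]
  refine Finset.sum_congr rfl fun k _ => ?_
  rw [Int.cast_sub, sub_mul, Real.cos_sub]; module

lemma sum_sin_shift (hn : 0 < n) (F : ℤ → L) (hF : ∀ m : ℤ, F (m + (2 * n : ℕ)) = F m) (t m : ℤ) :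
    ∑ k ∈ Finset.range (2 * n), Real.sin ((k:ℤ) * th n t) • F (m - k) =
      Real.sin (m * th n t) • cS n F t - Real.cos (m * th n t) • sS n F t := by
  have h1 := sum_refl (2 * n) (fun k : ℤ => Real.sin ((m - k : ℤ) * th n t) • F k) (by
    intro k
    rw [hF, ← sin_per hn t (m - (k + (2 * n : ℕ)))]
    congr 4; ring) m
  simp only [sub_sub_cancel] at h1
  rw [h1, cS, sS, Finset.smul_sum, Finset.smul_sum, ← Finset.sum_sub_distrib]
  refine Finset.sum_congr rfl fun k _ => ?_
  rw [Int.cast_sub, sub_mul, Real.sin_sub]; module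

lemma sum_sin_shift' (hn : 0 < n) (F : ℤ → L) (hF : ∀ m : ℤ, F (m + (2 * n : ℕ)) = F m) (t m : ℤ) :
    ∑ k ∈ Finset.range (2 * n), Real.sin ((k:ℤ) * th n t) • F (m + k) =
      Real.cos (m * th n t) • sS n F t - Real.sin (m * th n t) • cS n F t := by
  have h1 := sum_shift (2 * n) (fun k : ℤ => Real.sin ((k - m : ℤ) * th n t) • F k) (by
    intro k
    rw [hF, ← sin_per hn t (k - m)]
    congr 4; ring) m
  simp only [add_sub_cancel_right] at h1
  simp only [add_comm m]
  rw [h1, cS, sS, Finset.smul_sum, Finset.smul_sum, ← Finset.sum_sub_distrib]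
  refine Finset.sum_congr rfl fun k _ => ?_
  rw [Int.cast_sub, sub_mul, Real.sin_sub]; module

lemma cG (h : Ons n A G) (hn : 0 < n) (t : ℤ) : cS n G t = 0 := by
  have h1 := sum_neg' (2 * n) (fun k : ℤ => Real.cos (k * th n t) • G k) (by
    intro k; rw [h.perG', cos_per hn])
  have h2 : ∑ k ∈ Finset.range (2 * n), (fun k : ℤ => Real.cos (k * th n t) • G k) (-(k:ℤ)) = - cS n G t := by
    rw [cS, ← Finset.sum_neg_distrib]
    refine Finset.sum_congr rfl fun k _ => ?_
    simp only
    rw [h.odd, Int.cast_neg, neg_mul, Real.cos_neg, smul_neg]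
  rw [h2] at h1
  have h3 : - cS n G t = cS n G t := h1
  have h4 : (2:ℝ) • cS n G t = 0 := by
    linear_combination (norm := module) (-1:ℝ) • h3
  exact (smul_eq_zero.mp h4).resolve_left two_ne_zero

lemma A_c (h : Ons n A G) (hn : 0 < n) (m t : ℤ) :
    ⁅A m, cS n A t⁆ = (-2 * Real.sin (m * th n t)) • sS n G t := by
  have := sum_cos_shift hn G h.perG' t m
  rw [h.cG hn, smul_zero, zero_add] at this
  rw [cS, lie_sum, mul_smul, ← this, Finset.smul_sum]
  refine Finset.sum_congr rfl fun k _ => ?_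
  rw [lie_smul, h.AA, smul_comm]

lemma A_s (h : Ons n A G) (hn : 0 < n) (m t : ℤ) :
    ⁅A m, sS n A t⁆ = (2 * Real.cos (m * th n t)) • sS n G t := by
  have := sum_sin_shift hn G h.perG' t m
  rw [h.cG hn, smul_zero, zero_sub] at this
  have e : (2 * Real.cos (m * th n t)) • sS n G t = (-2:ℝ) • -(Real.cos (m * th n t) • sS n G t) := by module
  rw [e, ← this, sS, lie_sum, Finset.smul_sum]
  refine Finset.sum_congr rfl fun k _ => ?_
  rw [lie_smul, h.AA, smul_comm]

lemma A_z (h : Ons n A G) (hn : 0 < n) (m t : ℤ) :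
    ⁅A m, sS n G t⁆ = (8 * Real.sin (m * th n t)) • cS n A t - (8 * Real.cos (m * th n t)) • sS n A t := by
  have h1 := sum_sin_shift hn A h.perA' t m
  have h2 := sum_sin_shift' hn A h.perA' t m
  have e : ⁅A m, sS n G t⁆ = (4:ℝ) • (∑ k ∈ Finset.range (2 * n), Real.sin ((k:ℤ) * th n t) • A (m - k)
      - ∑ k ∈ Finset.range (2 * n), Real.sin ((k:ℤ) * th n t) • A (m + k)) := by
    rw [sS, lie_sum, ← Finset.sum_sub_distrib, Finset.smul_sum]
    refine Finset.sum_congr rfl fun k _ => ?_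
    rw [lie_smul, ← lie_skew, h.GA]; module
  rw [e, h1, h2]; module

lemma ndvd {n : ℕ} {x : ℤ} (h0 : x ≠ 0) (h1 : x < 2 * n) (h2 : -(2 * n) < x) : ¬ ((2 * n : ℤ) ∣ x) := by
  rintro ⟨c, hc⟩
  have hc0 : c ≠ 0 := by rintro rfl; simp at hc; exact h0 hc
  rcases lt_or_gt_of_ne hc0 with h | h
  · nlinarith
  · nlinarith

lemma csum (hn : 0 < n) (t : ℤ) (ht : ¬ ((2 * n : ℤ) ∣ t)) :
    ∑ k ∈ Finset.range (2 * n), Real.cos ((k:ℤ) * th n t) = 0 := by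
  simpa [th] using cos_sum n hn t ht
lemma ssum (hn : 0 < n) (t : ℤ) : ∑ k ∈ Finset.range (2 * n), Real.sin ((k:ℤ) * th n t) = 0 := by
  have h1 := sum_neg' (2 * n) (fun k : ℤ => Real.sin (k * th n t)) (by
    intro k; rw [sin_per hn])
  simp only [Int.cast_neg, neg_mul, Real.sin_neg, Finset.sum_neg_distrib] at h1
  linarith

lemma th_add (n : ℕ) (i j : ℤ) : th n (i + j) = th n i + th n j := by unfold th; push_cast; ring
lemma th_sub (n : ℕ) (i j : ℤ) : th n (i - j) = th n i - th n j := by unfold th; push_cast; ring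

lemma orth_cc (hn : 0 < n) {i j : ℤ} (hi : 1 ≤ i) (hi' : i < n) (hj : 1 ≤ j) (hj' : j < n) :
    ∑ k ∈ Finset.range (2 * n), Real.cos ((k:ℤ) * th n i) * Real.cos ((k:ℤ) * th n j) = if i = j then (n:ℝ) else 0 := by
  have e : ∀ k : ℕ, Real.cos ((k:ℤ) * th n i) * Real.cos ((k:ℤ) * th n j) =
      1/2 * Real.cos ((k:ℤ) * th n (i - j)) + 1/2 * Real.cos ((k:ℤ) * th n (i + j)) := by
    intro k
    rw [th_add, th_sub, mul_sub, mul_add, Real.cos_sub, Real.cos_add]; ring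
  simp only [e]
  rw [Finset.sum_add_distrib, ← Finset.mul_sum, ← Finset.mul_sum,
    csum hn (i+j) (ndvd (by omega) (by omega) (by omega))]
  split_ifs with hij
  · subst hij; simp [th]
  · rw [csum hn (i-j) (ndvd (by omega) (by omega) (by omega))]; simp

lemma orth_ss (hn : 0 < n) {i j : ℤ} (hi : 1 ≤ i) (hi' : i < n) (hj : 1 ≤ j) (hj' : j < n) :
    ∑ k ∈ Finset.range (2 * n), Real.sin ((k:ℤ) * th n i) * Real.sin ((k:ℤ) * th n j) = if i = j then (n:ℝ) else 0 := by
  have e : ∀ k : ℕ, Real.sin ((k:ℤ) * th n i) * Real.sin ((k:ℤ) * th n j) =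
      1/2 * Real.cos ((k:ℤ) * th n (i - j)) - 1/2 * Real.cos ((k:ℤ) * th n (i + j)) := by
    intro k
    rw [th_add, th_sub, mul_sub, mul_add, Real.cos_sub, Real.cos_add]; ring
  simp only [e]
  rw [Finset.sum_sub_distrib, ← Finset.mul_sum, ← Finset.mul_sum,
    csum hn (i+j) (ndvd (by omega) (by omega) (by omega))]
  split_ifs with hij
  · subst hij; simp [th]
  · rw [csum hn (i-j) (ndvd (by omega) (by omega) (by omega))]; simp

lemma orth_cs (hn : 0 < n) (i j : ℤ) :
    ∑ k ∈ Finset.range (2 * n), Real.cos ((k:ℤ) * th n i) * Real.sin ((k:ℤ) * th n j) = 0 := by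
  have e : ∀ k : ℕ, Real.cos ((k:ℤ) * th n i) * Real.sin ((k:ℤ) * th n j) =
      1/2 * Real.sin ((k:ℤ) * th n (i + j)) - 1/2 * Real.sin ((k:ℤ) * th n (i - j)) := by
    intro k
    rw [th_add, th_sub, mul_sub, mul_add, Real.sin_sub, Real.sin_add]; ring
  simp only [e]
  rw [Finset.sum_sub_distrib, ← Finset.mul_sum, ← Finset.mul_sum, ssum hn, ssum hn]; simp

lemma br_cs (h : Ons n A G) (hn : 0 < n) {i j : ℤ} (hi : 1 ≤ i) (hi' : i < n) (hj : 1 ≤ j) (hj' : j < n) :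
    ⁅cS n A i, sS n A j⁆ = (if i = j then (2 * n:ℝ) else 0) • sS n G j := by
  have := orth_cc hn hi hi' hj hj'
  conv_lhs => rw [cS]
  rw [sum_lie]
  simp only [smul_lie, h.A_s hn, smul_smul]
  rw [← Finset.sum_smul]; congr 1
  rw [show (if i = j then (2 * n:ℝ) else 0) = 2 * (if i = j then (n:ℝ) else 0) by split_ifs <;> simp,
    ← this, Finset.mul_sum]
  exact Finset.sum_congr rfl fun k _ => by ring

lemma br_cc (h : Ons n A G) (hn : 0 < n) (i j : ℤ) : ⁅cS n A i, cS n A j⁆ = 0 := by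
  have := orth_cs hn i j
  conv_lhs => lhs; rw [cS]
  rw [sum_lie]
  simp only [smul_lie, h.A_c hn, smul_smul]
  rw [← Finset.sum_smul, ← zero_smul ℝ (sS n G j)]; congr 1
  rw [← mul_zero (-2:ℝ), ← this, Finset.mul_sum]
  exact Finset.sum_congr rfl fun k _ => by ring

lemma br_ss (h : Ons n A G) (hn : 0 < n) (i j : ℤ) : ⁅sS n A i, sS n A j⁆ = 0 := by
  have := orth_cs hn j i
  conv_lhs => lhs; rw [sS]
  rw [sum_lie]
  simp only [smul_lie, h.A_s hn, smul_smul]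
  rw [← Finset.sum_smul, ← zero_smul ℝ (sS n G j)]; congr 1
  rw [← mul_zero (2:ℝ), ← this, Finset.mul_sum]
  exact Finset.sum_congr rfl fun k _ => by ring

lemma br_cz (h : Ons n A G) (hn : 0 < n) {i j : ℤ} (hi : 1 ≤ i) (hi' : i < n) (hj : 1 ≤ j) (hj' : j < n) :
    ⁅cS n A i, sS n G j⁆ = (if i = j then (-8 * n:ℝ) else 0) • sS n A j := by
  have e1 := orth_cc hn hi hi' hj hj'
  have e2 := orth_cs hn i j
  have : ⁅cS n A i, sS n G j⁆ = (8 * ∑ k ∈ Finset.range (2 * n), Real.cos ((k:ℤ) * th n i) * Real.sin ((k:ℤ) * th n j)) • cS n A j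
     - (8 * ∑ k ∈ Finset.range (2 * n), Real.cos ((k:ℤ) * th n i) * Real.cos ((k:ℤ) * th n j)) • sS n A j := by
    conv_lhs => lhs; rw [cS]
    rw [sum_lie, Finset.mul_sum, Finset.mul_sum, Finset.sum_smul, Finset.sum_smul, ← Finset.sum_sub_distrib]
    refine Finset.sum_congr rfl fun k _ => ?_
    rw [smul_lie, h.A_z hn]; module
  rw [this, e1, e2]; split_ifs <;> module

lemma br_sz (h : Ons n A G) (hn : 0 < n) {i j : ℤ} (hi : 1 ≤ i) (hi' : i < n) (hj : 1 ≤ j) (hj' : j < n) :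
    ⁅sS n A i, sS n G j⁆ = (if i = j then (8 * n:ℝ) else 0) • cS n A j := by
  have e1 := orth_ss hn hi hi' hj hj'
  have e2 := orth_cs hn j i
  have : ⁅sS n A i, sS n G j⁆ = (8 * ∑ k ∈ Finset.range (2 * n), Real.sin ((k:ℤ) * th n i) * Real.sin ((k:ℤ) * th n j)) • cS n A j
     - (8 * ∑ k ∈ Finset.range (2 * n), Real.cos ((k:ℤ) * th n j) * Real.sin ((k:ℤ) * th n i)) • sS n A j := by
    conv_lhs => lhs; rw [sS]
    rw [sum_lie, Finset.mul_sum, Finset.mul_sum, Finset.sum_smul, Finset.sum_smul, ← Finset.sum_sub_distrib]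
    refine Finset.sum_congr rfl fun k _ => ?_
    rw [smul_lie, h.A_z hn]; module
  rw [this, e1, e2]; split_ifs <;> module

/-- Fourier inversion -/
lemma inv_A (_h : Ons n A G) (hn : 0 < n) {m : ℕ} (hm : m < 2 * n) :
    A m = (1 / (2 * n) : ℝ) • ∑ j ∈ Finset.range (2 * n),
      (Real.cos (m * th n j) • cS n A j + Real.sin (m * th n j) • sS n A j) := by
  have hn' : (n:ℝ) ≠ 0 := by exact_mod_cast hn.ne'
  have e : ∑ j ∈ Finset.range (2 * n),
      (Real.cos (m * th n j) • cS n A j + Real.sin (m * th n j) • sS n A j) =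
      ∑ k ∈ Finset.range (2 * n), (∑ j ∈ Finset.range (2 * n), Real.cos ((j : ℤ) * th n (k - m))) • A k := by
    simp only [cS, sS, Finset.smul_sum, Finset.sum_smul, ← Finset.sum_add_distrib]
    rw [Finset.sum_comm]
    refine Finset.sum_congr rfl fun k _ => Finset.sum_congr rfl fun j _ => ?_
    have : ((j:ℤ):ℝ) * th n (k - m) = (k:ℤ) * th n j - m * th n j := by unfold th; push_cast; ring
    rw [this, Real.cos_sub]; module
  rw [e, Finset.sum_eq_single m]
  · simp [th, smul_smul]; field_simp; simp
  · intro k hk hkm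
    rw [Finset.mem_range] at hk
    rw [csum hn _ (ndvd (by omega) (by omega) (by omega)), zero_smul]
  · intro h; exact absurd (Finset.mem_range.mpr hm) h

end Ons
end

section absDecomp
variable {L : Type*} [LieRing L] [LieAlgebra ℝ L]

/-- the elements commuting with a set -/
def cent (S : Set L) : Submodule ℝ L where
  carrier := {x | ∀ y ∈ S, ⁅x, y⁆ = 0}
  zero_mem' := fun y _ => zero_lie y
  add_mem' := fun hx hy z hz => by rw [add_lie, hx z hz, hy z hz, add_zero]
  smul_mem' := fun r x hx z hz => by rw [smul_lie, hx z hz, smul_zero]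

/-- the normalizer of a subspace -/
def nrm (J : Submodule ℝ L) : LieSubalgebra ℝ L where
  carrier := {x | ∀ y ∈ J, ⁅x, y⁆ ∈ J}
  zero_mem' := fun y _ => by rw [zero_lie]; exact J.zero_mem
  add_mem' := fun hx hy z hz => by rw [add_lie]; exact J.add_mem (hx z hz) (hy z hz)
  smul_mem' := fun r x hx z hz => by rw [smul_lie]; exact J.smul_mem r (hx z hz)
  lie_mem' := fun {x y} hx hy z hz => by
    rw [lie_lie]; exact J.sub_mem (hx _ (hy z hz)) (hy _ (hx z hz))

lemma ad_stable {s : Set L} {J : Submodule ℝ L} (h : ∀ x ∈ s, ∀ y ∈ J, ⁅x, y⁆ ∈ J) :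
    ∀ x ∈ LieSubalgebra.lieSpan ℝ L s, ∀ y ∈ J, ⁅x, y⁆ ∈ J := by
  have : LieSubalgebra.lieSpan ℝ L s ≤ nrm J := LieSubalgebra.lieSpan_le.mpr h
  exact fun x hx => this hx

lemma lieSpan_le_sub {s : Set L} {V : Submodule ℝ L} (hs : s ⊆ V) (h : ∀ x ∈ s, ∀ y ∈ V, ⁅x, y⁆ ∈ V) :
    (LieSubalgebra.lieSpan ℝ L s).toSubmodule ≤ V := by
  let V' : LieSubalgebra ℝ L :=
    { V ⊓ (nrm V).toSubmodule with
      lie_mem' := fun {x y} hx hy => ⟨hx.2 _ hy.1, (nrm V).lie_mem hx.2 hy.2⟩ }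
  have : LieSubalgebra.lieSpan ℝ L s ≤ V' := LieSubalgebra.lieSpan_le.mpr fun x hx => ⟨hs hx, h x hx⟩
  exact fun x hx => (this hx).1

lemma commute_lieSpan {s : Set L} {k : L} (h : ∀ x ∈ s, ⁅x, k⁆ = 0) :
    ∀ x ∈ LieSubalgebra.lieSpan ℝ L s, ⁅k, x⁆ = 0 := by
  have h1 := ad_stable (s := s) (J := Submodule.span ℝ {k}) (by
    intro x hx y hy
    obtain ⟨c, rfl⟩ := Submodule.mem_span_singleton.mp hy
    rw [lie_smul, h x hx, smul_zero]; exact Submodule.zero_mem _)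
  let V' : LieSubalgebra ℝ L :=
    { cent {k} with
      lie_mem' := fun {x y} hx hy z hz => by
        obtain rfl : z = k := hz
        rw [lie_lie, hy z rfl, hx z rfl, lie_zero, lie_zero, sub_zero] }
  have : LieSubalgebra.lieSpan ℝ L s ≤ V' := LieSubalgebra.lieSpan_le.mpr fun x hx z hz => by
    obtain rfl : z = k := hz
    exact h x hx
  intro x hx
  have h2 : ⁅x, k⁆ = 0 := this hx k rfl
  rw [← lie_skew, h2, neg_zero]

variable {ι : Type*} {D : LieSubalgebra ℝ L} {K : Submodule ℝ L} {J : ι → Submodule ℝ L}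

lemma abs_comm_sum (hIJ : ∀ i j, i ≠ j → ∀ x ∈ J i, ∀ y ∈ J j, ⁅x, y⁆ = 0)
    (hZ : ∀ i, ∀ x ∈ J i, (∀ y ∈ J i, ⁅x, y⁆ = 0) → x = 0)
    (x : L) (hx : x ∈ ⨆ i, J i) (hc : ∀ i, ∀ y ∈ J i, ⁅x, y⁆ = 0) : x = 0 := by
  classical
  obtain ⟨f, hf, rfl⟩ := (Submodule.mem_iSup_iff_exists_finsupp J x).mp hx
  refine Finset.sum_eq_zero fun i hi => ?_
  apply hZ i _ (hf i)
  intro y hy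
  have := hc i y hy
  rw [Finsupp.sum, sum_lie, Finset.sum_eq_single i] at this
  · exact this
  · intro j _ hji; exact hIJ j i hji _ (hf j) _ hy
  · intro h; exact absurd hi h

lemma abs_center (hW : K ⊔ ⨆ i, J i = D.toSubmodule) (hK : ∀ k ∈ K, ∀ x ∈ D, ⁅k, x⁆ = 0)
    (hIJ : ∀ i j, i ≠ j → ∀ x ∈ J i, ∀ y ∈ J j, ⁅x, y⁆ = 0)
    (hZ : ∀ i, ∀ x ∈ J i, (∀ y ∈ J i, ⁅x, y⁆ = 0) → x = 0)
    (z : L) (hz : z ∈ D) (hc : ∀ x ∈ D, ⁅z, x⁆ = 0) : z ∈ K := by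
  have hJD : ∀ i, J i ≤ D.toSubmodule := fun i => hW ▸ (le_iSup J i).trans le_sup_right
  have hz' : z ∈ K ⊔ ⨆ i, J i := by rw [hW]; exact hz
  obtain ⟨k, hk, x, hx, rfl⟩ := Submodule.mem_sup.mp hz'
  have : x = 0 := by
    refine abs_comm_sum hIJ hZ x hx fun i y hy => ?_
    have := hc y (hJD i hy)
    rwa [add_lie, hK k hk y (hJD i hy), zero_add] at this
  rw [this, add_zero]; exact hk

lemma abs_indep (hW : K ⊔ ⨆ i, J i = D.toSubmodule) (hK : ∀ k ∈ K, ∀ x ∈ D, ⁅k, x⁆ = 0)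
    (hIJ : ∀ i j, i ≠ j → ∀ x ∈ J i, ∀ y ∈ J j, ⁅x, y⁆ = 0)
    (hZ : ∀ i, ∀ x ∈ J i, (∀ y ∈ J i, ⁅x, y⁆ = 0) → x = 0)
    (F : Option ι → Submodule ℝ L) (hF0 : F none = K) (hF1 : ∀ i, F (some i) = J i) (i : Option ι) :
    Disjoint (F i) (⨆ j, ⨆ (_ : j ≠ i), F j) := by
  have hJD : ∀ i, J i ≤ D.toSubmodule := fun i => hW ▸ (le_iSup J i).trans le_sup_right
  rw [Submodule.disjoint_def]
  intro x hx hx'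
  cases i with
  | none =>
    rw [hF0] at hx
    refine abs_comm_sum hIJ hZ x ?_ fun i y hy => hK x hx y (hJD i hy)
    refine (iSup₂_le ?_ : _ ≤ ⨆ i, J i) hx'
    intro j hj
    cases j with
    | none => exact absurd rfl hj
    | some j => rw [hF1]; exact le_iSup J j
  | some i =>
    rw [hF1] at hx
    refine hZ i x hx ?_
    refine (iSup₂_le ?_ : _ ≤ cent (J i : Set L)) hx'
    intro j hj
    cases j with
    | none => rw [hF0]; exact fun k hk y hy => hK k hk y (hJD i hy)
    | some j => rw [hF1]; exact fun k hk y hy => hIJ j i (fun h => hj (by rw [h])) k hk y hy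

/-- a rescaled `su(2)` triple -/
structure Trip (n : ℕ) (c s z : L) : Prop where
  cs : ⁅c, s⁆ = (2 * n : ℝ) • z
  sz : ⁅s, z⁆ = (8 * n : ℝ) • c
  cz : ⁅c, z⁆ = (-8 * n : ℝ) • s
  ne : z ≠ 0
  pos : 0 < n

namespace Trip
variable {n : ℕ} {c s z : L}

lemma bracket (h : Trip n c s z) (a b d a' b' d' : ℝ) :
    ⁅a • c + b • s + d • z, a' • c + b' • s + d' • z⁆ =
      ((b * d' - d * b') * (8 * n)) • c + ((d * a' - a * d') * (8 * n)) • s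
        + ((a * b' - b * a') * (2 * n)) • z := by
  have e1 : ⁅s, c⁆ = -((2 * n : ℝ) • z) := by rw [← lie_skew, h.cs]
  have e2 : ⁅z, s⁆ = -((8 * n : ℝ) • c) := by rw [← lie_skew, h.sz]
  have e3 : ⁅z, c⁆ = -((-8 * n : ℝ) • s) := by rw [← lie_skew, h.cz]
  simp only [add_lie, lie_add, smul_lie, lie_smul, lie_self, h.cs, h.sz, h.cz, e1, e2, e3]
  module

lemma li (h : Trip n c s z) (a b d : ℝ) (h0 : a • c + b • s + d • z = 0) : a = 0 ∧ b = 0 ∧ d = 0 := by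
  have hn : (n:ℝ) ≠ 0 := by exact_mod_cast h.pos.ne'
  have hs : s ≠ 0 := by
    intro hs; have := h.cs; rw [hs, lie_zero] at this
    rcases smul_eq_zero.mp this.symm with h1 | h1
    · exact hn (by linarith)
    · exact h.ne h1
  have hc : c ≠ 0 := by
    intro hs; have := h.cs; rw [hs, zero_lie] at this
    rcases smul_eq_zero.mp this.symm with h1 | h1
    · exact hn (by linarith)
    · exact h.ne h1
  have hb : b = 0 := by
    have h1 := h.bracket a b d 1 0 0
    rw [h0, zero_lie] at h1
    have h2 := congrArg (fun x => ⁅s, x⁆) h1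
    simp only [lie_zero, lie_add, lie_smul, lie_self, h.sz, smul_zero] at h2
    have h3 : (b * (-16 * n^2)) • c = 0 := by
      rw [h2, show ⁅s, c⁆ = -((2 * n : ℝ) • z) by rw [← lie_skew, h.cs]]; module
    rcases smul_eq_zero.mp h3 with h4 | h4
    · rcases mul_eq_zero.mp h4 with h5 | h5
      · exact h5
      · exfalso; apply hn; nlinarith [sq_nonneg (n:ℝ)]
    · exact absurd h4 hc
  subst hb
  have hd : d = 0 := by
    have h1 := h.bracket a 0 d 1 0 0
    rw [h0, zero_lie] at h1
    have h3 : (d * (8 * n)) • s = 0 := by rw [h1]; module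
    rcases smul_eq_zero.mp h3 with h4 | h4
    · rcases mul_eq_zero.mp h4 with h5 | h5
      · exact h5
      · exact absurd (by linarith) hn
    · exact absurd h4 hs
  subst hd
  rw [zero_smul, zero_smul, add_zero, add_zero] at h0
  exact ⟨(smul_eq_zero.mp h0).resolve_right hc, rfl, rfl⟩

lemma mem_span (x : L) : x ∈ Submodule.span ℝ {c, s, z} ↔ ∃ a b d : ℝ, x = a • c + b • s + d • z := by
  rw [Submodule.mem_span_triple]
  constructor
  · rintro ⟨a, b, d, h⟩; exact ⟨a, b, d, h.symm⟩
  · rintro ⟨a, b, d, h⟩; exact ⟨a, b, d, h.symm⟩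

lemma linInd (h : Trip n c s z) : LinearIndependent ℝ ![c, s, z] := by
  rw [Fintype.linearIndependent_iff]
  intro g hg
  rw [Fin.sum_univ_three] at hg
  obtain ⟨h1, h2, h3⟩ := h.li _ _ _ hg
  intro i; fin_cases i
  · exact h1
  · exact h2
  · exact h3

lemma rank (h : Trip n c s z) : Module.finrank ℝ (Submodule.span ℝ {c, s, z}) = 3 := by
  have := finrank_span_eq_card h.linInd
  have hr : Set.range ![c, s, z] = {c, s, z} := by
    rw [Matrix.range_cons, Matrix.range_cons, Matrix.range_cons, Matrix.range_empty, Set.union_empty]; rfl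
  rw [hr] at this
  simpa using this

lemma centerless (h : Trip n c s z) (x : L) (hx : x ∈ Submodule.span ℝ {c, s, z})
    (hc : ∀ y ∈ Submodule.span ℝ {c, s, z}, ⁅x, y⁆ = 0) : x = 0 := by
  have hn : (n:ℝ) ≠ 0 := by exact_mod_cast h.pos.ne'
  obtain ⟨a, b, d, rfl⟩ := (mem_span x).mp hx
  have h1 := hc (1 • c + 0 • s + 0 • z) ((mem_span _).mpr ⟨1, 0, 0, by module⟩)
  have h2 := hc (0 • c + 1 • s + 0 • z) ((mem_span _).mpr ⟨0, 1, 0, by module⟩)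
  have e1 := h.bracket a b d 1 0 0
  have e2 := h.bracket a b d 0 1 0
  rw [show (1:ℝ) • c + (0:ℝ) • s + (0:ℝ) • z = 1 • c + 0 • s + 0 • z by module, h1] at e1
  rw [show (0:ℝ) • c + (1:ℝ) • s + (0:ℝ) • z = 0 • c + 1 • s + 0 • z by module, h2] at e2
  obtain ⟨_, f2, f3⟩ := h.li _ _ _ e1.symm
  obtain ⟨_, _, g3⟩ := h.li _ _ _ e2.symm
  have ha : a = 0 := by
    rcases mul_eq_zero.mp g3 with h | h
    · linarith
    · exact absurd (by linarith) hn
  have hb : b = 0 := by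
    rcases mul_eq_zero.mp f3 with h | h
    · linarith
    · exact absurd (by linarith) hn
  have hd : d = 0 := by
    rcases mul_eq_zero.mp f2 with h | h
    · linarith
    · exact absurd (by linarith) hn
  rw [ha, hb, hd]; module

/-- coordinates to `su(2)` -/
def toSu (n : ℕ) : (Fin 3 → ℝ) →ₗ[ℝ] Matrix (Fin 2) (Fin 2) ℂ where
  toFun v := !![-(4 * n * v 2 : ℝ) * Complex.I, (2 * n * v 0 : ℝ) * Complex.I + (2 * n * v 1 : ℝ);
    (2 * n * v 0 : ℝ) * Complex.I - (2 * n * v 1 : ℝ), (4 * n * v 2 : ℝ) * Complex.I]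
  map_add' v w := by
    ext i j; fin_cases i <;> fin_cases j <;> simp <;> ring
  map_smul' r v := by
    ext i j; fin_cases i <;> fin_cases j <;> simp <;> ring

lemma exists_su (h : Trip n c s z) : ∃ f : L →ₗ[ℝ] Matrix (Fin 2) (Fin 2) ℂ,
    Set.BijOn f (Submodule.span ℝ {c, s, z} : Set L)
      {A : Matrix (Fin 2) (Fin 2) ℂ | Aᴴ = -A ∧ Matrix.trace A = 0} ∧
    ∀ A ∈ Submodule.span ℝ {c, s, z}, ∀ B ∈ Submodule.span ℝ {c, s, z}, f ⁅A, B⁆ = ⁅f A, f B⁆ := by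
  have hn : (n:ℝ) ≠ 0 := by exact_mod_cast h.pos.ne'
  have hnc : (n:ℂ) ≠ 0 := by exact_mod_cast h.pos.ne'
  obtain ⟨g, hg⟩ := LinearMap.exists_leftInverse_of_injective (Fintype.linearCombination ℝ ![c, s, z])
    (by
      rw [LinearMap.ker_eq_bot']
      intro m hm
      exact funext (Fintype.linearIndependent_iff.mp h.linInd m (by simpa [Fintype.linearCombination_apply] using hm)))
  have hg' : ∀ a b d : ℝ, g (a • c + b • s + d • z) = ![a, b, d] := by
    intro a b d
    have := LinearMap.congr_fun hg ![a, b, d]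
    simpa [Fintype.linearCombination_apply, Fin.sum_univ_three] using this
  refine ⟨toSu n ∘ₗ g, ⟨?_, ?_, ?_⟩, ?_⟩
  · intro x hx
    obtain ⟨a, b, d, rfl⟩ := (mem_span x).mp hx
    refine ⟨?_, ?_⟩
    · rw [LinearMap.comp_apply, hg']
      ext i j; fin_cases i <;> fin_cases j <;> simp [toSu, Matrix.conjTranspose_apply] <;> ring
    · rw [LinearMap.comp_apply, hg']
      simp [toSu, Matrix.trace_fin_two]
  · intro x hx y hy hxy
    obtain ⟨a, b, d, rfl⟩ := (mem_span x).mp hx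
    obtain ⟨a', b', d', rfl⟩ := (mem_span y).mp hy
    simp only [LinearMap.comp_apply, hg'] at hxy
    have e1 := congrFun (congrFun hxy 0) 1
    have e2 := congrFun (congrFun hxy 1) 1
    simp [toSu] at e1 e2
    have i1 := congrArg Complex.im e1
    have r1 := congrArg Complex.re e1
    simp at i1 r1
    have ha : a = a' := i1.resolve_right h.pos.ne'
    have hb : b = b' := r1.resolve_right h.pos.ne'
    have hd : d = d' := e2.resolve_right h.pos.ne'
    rw [ha, hb, hd]
  · rintro B ⟨hB1, hB2⟩
    have q00 := congrFun (congrFun hB1 0) 0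
    have q01 := congrFun (congrFun hB1 0) 1
    have tr := hB2
    rw [Matrix.trace_fin_two] at tr
    simp only [Matrix.conjTranspose_apply, Matrix.neg_apply] at q00 q01
    obtain ⟨a, ha⟩ : ∃ a : ℝ, 2 * n * a = (B 0 1).im := ⟨(B 0 1).im / (2 * n), by field_simp⟩
    obtain ⟨b, hb⟩ : ∃ a : ℝ, 2 * n * a = (B 0 1).re := ⟨(B 0 1).re / (2 * n), by field_simp⟩
    obtain ⟨d, hd⟩ : ∃ a : ℝ, 4 * n * a = (B 1 1).im := ⟨(B 1 1).im / (4 * n), by field_simp⟩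
    refine ⟨a • c + b • s + d • z, (mem_span _).mpr ⟨_, _, _, rfl⟩, ?_⟩
    rw [LinearMap.comp_apply, hg']
    have t1 := congrArg Complex.re q00
    have t2 := congrArg Complex.re q01
    have t3 := congrArg Complex.im q01
    have t4 := congrArg Complex.re tr
    have t5 := congrArg Complex.im tr
    simp at t1 t2 t3 t4 t5
    ext i j; fin_cases i <;> fin_cases j <;> apply Complex.ext <;> simp [toSu] <;> linarith
  · intro x hx y hy
    obtain ⟨a, b, d, rfl⟩ := (mem_span x).mp hx
    obtain ⟨a', b', d', rfl⟩ := (mem_span y).mp hy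
    rw [h.bracket]
    simp only [LinearMap.comp_apply, hg', Ring.lie_def]
    have hI := Complex.I_sq
    ext i j; fin_cases i <;> fin_cases j <;> simp [toSu, Matrix.mul_apply, Fin.sum_univ_two] <;>
      ring_nf <;> simp only [hI] <;> ring

end Trip
end absDecomp


namespace Ons
variable {L : Type*} [LieRing L] [LieAlgebra ℝ L] {n : ℕ} {A G : ℤ → L}

/-- the generated Lie algebra -/
abbrev DD (A : ℤ → L) : LieSubalgebra ℝ L := LieSubalgebra.lieSpan ℝ L {A 1, -(A 0)}
/-- the three dimensional blocks -/
abbrev JJ (n : ℕ) (A G : ℤ → L) (j : ℤ) : Submodule ℝ L :=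
  Submodule.span ℝ {cS n A j, sS n A j, sS n G j}
/-- the central part -/
abbrev KK (n : ℕ) (A : ℤ → L) : Submodule ℝ L := Submodule.span ℝ {cS n A 0, cS n A n}

lemma A0_mem : A 0 ∈ DD A := by
  have : -(A 0) ∈ DD A := LieSubalgebra.subset_lieSpan (by simp)
  simpa using (DD A).neg_mem this

lemma A1_mem : A 1 ∈ DD A := LieSubalgebra.subset_lieSpan (by simp)

lemma G_of (h : Ons n A G) (m : ℤ) (hm : A m ∈ DD A) : G m ∈ DD A := by
  have e1 : G m = (1/2:ℝ) • ⁅A 0, A m⁆ := by rw [h.h0]; module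
  rw [e1]; exact (DD A).smul_mem _ ((DD A).lie_mem A0_mem hm)

lemma A_mem (h : Ons n A G) (m : ℤ) : A m ∈ DD A := by
  have g1 := h.G_of 1 A1_mem
  refine two_ind (p := fun m => A m ∈ DD A) 0 A0_mem A1_mem ?_ ?_ m
  · intro m h1 h2
    have e : A (m+1) = (1/4:ℝ) • ⁅G 1, A m⁆ + A (m-1) := by rw [h.g1A]; module
    rw [e]; exact (DD A).add_mem ((DD A).smul_mem _ ((DD A).lie_mem g1 h2)) h1
  · intro m h1 h2
    have e : A (m-1) = A (m+1) - (1/4:ℝ) • ⁅G 1, A m⁆ := by rw [h.g1A]; module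
    rw [e]; exact (DD A).sub_mem h2 ((DD A).smul_mem _ ((DD A).lie_mem g1 h1))

lemma G_mem (h : Ons n A G) (m : ℤ) : G m ∈ DD A := h.G_of m (h.A_mem m)

lemma cS_mem (h : Ons n A G) (t : ℤ) : cS n A t ∈ (DD A).toSubmodule :=
  Submodule.sum_mem _ fun k _ => Submodule.smul_mem _ _ (h.A_mem k)
lemma sS_mem (h : Ons n A G) (t : ℤ) : sS n A t ∈ (DD A).toSubmodule :=
  Submodule.sum_mem _ fun k _ => Submodule.smul_mem _ _ (h.A_mem k)
lemma sG_mem (h : Ons n A G) (t : ℤ) : sS n G t ∈ (DD A).toSubmodule :=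
  Submodule.sum_mem _ fun k _ => Submodule.smul_mem _ _ (h.G_mem k)

lemma JJ_le (h : Ons n A G) (t : ℤ) : JJ n A G t ≤ (DD A).toSubmodule := by
  rw [Submodule.span_le]
  rintro x (rfl | rfl | rfl)
  · exact h.cS_mem t
  · exact h.sS_mem t
  · exact h.sG_mem t

lemma KK_le (h : Ons n A G) : KK n A ≤ (DD A).toSubmodule := by
  rw [Submodule.span_le]
  rintro x (rfl | rfl)
  · exact h.cS_mem 0
  · exact h.cS_mem n

lemma trip (h : Ons n A G) (hn : 0 < n) {j : ℤ} (hj : 1 ≤ j) (hj' : j < n) (hz : sS n G j ≠ 0) :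
    Trip n (cS n A j) (sS n A j) (sS n G j) where
  cs := by rw [h.br_cs hn hj hj' hj hj', if_pos rfl]
  sz := by rw [h.br_sz hn hj hj' hj hj', if_pos rfl]
  cz := by rw [h.br_cz hn hj hj' hj hj', if_pos rfl]
  ne := hz
  pos := hn

lemma JJ_A (h : Ons n A G) (hn : 0 < n) (m t : ℤ) : ∀ y ∈ JJ n A G t, ⁅A m, y⁆ ∈ JJ n A G t := by
  intro y hy
  obtain ⟨a, b, d, rfl⟩ := (Trip.mem_span y).mp hy
  rw [lie_add, lie_add, lie_smul, lie_smul, lie_smul, h.A_c hn, h.A_s hn, h.A_z hn]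
  refine (Trip.mem_span _).mpr ⟨d * (8 * Real.sin (m * th n t)), - d * (8 * Real.cos (m * th n t)),
    a * (-2 * Real.sin (m * th n t)) + b * (2 * Real.cos (m * th n t)), ?_⟩
  module

lemma JJ_gen (h : Ons n A G) (hn : 0 < n) (t : ℤ) :
    ∀ x ∈ ({A 1, -(A 0)} : Set L), ∀ y ∈ JJ n A G t, ⁅x, y⁆ ∈ JJ n A G t := by
  rintro x (rfl | rfl) y hy
  · exact h.JJ_A hn 1 t y hy
  · rw [neg_lie]; exact Submodule.neg_mem _ (h.JJ_A hn 0 t y hy)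

lemma JJ_ideal (h : Ons n A G) (hn : 0 < n) (t : ℤ) : ∀ x ∈ DD A, ∀ y ∈ JJ n A G t, ⁅x, y⁆ ∈ JJ n A G t :=
  ad_stable (h.JJ_gen hn t)

lemma br_zz (h : Ons n A G) (hn : 0 < n) {i j : ℤ} (hi : 1 ≤ i) (hi' : i < n) (hj : 1 ≤ j) (hj' : j < n)
    (hij : i ≠ j) : ⁅sS n G i, sS n G j⁆ = 0 := by
  have hn' : (n:ℝ) ≠ 0 := by exact_mod_cast hn.ne'
  have e : sS n G i = (1 / (2 * n) : ℝ) • ⁅cS n A i, sS n A i⁆ := by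
    rw [h.br_cs hn hi hi' hi hi', if_pos rfl, smul_smul]
    field_simp; rw [one_smul]
  rw [e, smul_lie, lie_lie, h.br_cz hn hi hi' hj hj', h.br_sz hn hi hi' hj hj', if_neg hij, if_neg hij]
  simp

lemma JJ_comm (h : Ons n A G) (hn : 0 < n) {i j : ℤ} (hi : 1 ≤ i) (hi' : i < n) (hj : 1 ≤ j) (hj' : j < n)
    (hij : i ≠ j) : ∀ x ∈ JJ n A G i, ∀ y ∈ JJ n A G j, ⁅x, y⁆ = 0 := by
  intro x hx y hy
  obtain ⟨a, b, d, rfl⟩ := (Trip.mem_span x).mp hx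
  obtain ⟨a', b', d', rfl⟩ := (Trip.mem_span y).mp hy
  have e1 := h.br_cs hn hi hi' hj hj'
  have e2 := h.br_cz hn hi hi' hj hj'
  have e3 := h.br_sz hn hi hi' hj hj'
  have f1 := h.br_cs hn hj hj' hi hi'
  have f2 := h.br_cz hn hj hj' hi hi'
  have f3 := h.br_sz hn hj hj' hi hi'
  rw [if_neg hij, zero_smul] at e1 e2 e3
  rw [if_neg hij.symm, zero_smul] at f1 f2 f3
  rw [← lie_skew, neg_eq_zero] at f1 f2 f3
  simp only [add_lie, lie_add, smul_lie, lie_smul, e1, e2, e3, f1, f2, f3, h.br_cc hn, h.br_ss hn,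
    h.br_zz hn hi hi' hj hj' hij, smul_zero, add_zero]

lemma sin_th_zero (m : ℤ) : Real.sin (m * th n 0) = 0 := by simp [th]
lemma sin_th_n (hn : 0 < n) (m : ℤ) : Real.sin (m * th n n) = 0 := by
  have hn' : (n:ℝ) ≠ 0 := by exact_mod_cast hn.ne'
  have : (m:ℝ) * th n n = m * Real.pi := by unfold th; push_cast; field_simp
  rw [this]; exact Real.sin_int_mul_pi m

lemma KK_central (h : Ons n A G) (hn : 0 < n) : ∀ k ∈ KK n A, ∀ x ∈ DD A, ⁅k, x⁆ = 0 := by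
  intro k hk
  refine commute_lieSpan ?_
  have key : ∀ m : ℤ, ⁅A m, k⁆ = 0 := by
    intro m
    obtain ⟨a, b, rfl⟩ := Submodule.mem_span_pair.mp hk
    rw [lie_add, lie_smul, lie_smul, h.A_c hn, h.A_c hn, sin_th_zero, sin_th_n hn]
    simp
  rintro x (rfl | rfl)
  · exact key 1
  · rw [neg_lie, key 0, neg_zero]

lemma cS_refl (hn : 0 < n) (t : ℤ) : cS n A (2 * n - t) = cS n A t := by
  have hn' : (n:ℝ) ≠ 0 := by exact_mod_cast hn.ne'
  unfold cS
  refine Finset.sum_congr rfl fun k _ => ?_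
  have : ((k:ℤ):ℝ) * th n (2 * n - t) = (k:ℤ) * (2 * Real.pi) - (k:ℤ) * th n t := by
    unfold th; push_cast; field_simp
  rw [this, Real.cos_int_mul_two_pi_sub]

lemma sS_refl (hn : 0 < n) (t : ℤ) : sS n A (2 * n - t) = - sS n A t := by
  have hn' : (n:ℝ) ≠ 0 := by exact_mod_cast hn.ne'
  unfold sS
  rw [← Finset.sum_neg_distrib]
  refine Finset.sum_congr rfl fun k _ => ?_
  have : ((k:ℤ):ℝ) * th n (2 * n - t) = (k:ℤ) * (2 * Real.pi) - (k:ℤ) * th n t := by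
    unfold th; push_cast; field_simp
  rw [this, Real.sin_int_mul_two_pi_sub, neg_smul]

lemma A_in (h : Ons n A G) (hn : 0 < n) (V : Submodule ℝ L) (hK : KK n A ≤ V)
    (hJ : ∀ j : ℤ, 1 ≤ j → j < n → JJ n A G j ≤ V) {m : ℕ} (hm : m < 2 * n) : A m ∈ V := by
  have hc : ∀ j : ℤ, 1 ≤ j → j < n → cS n A j ∈ V := fun j h1 h2 => hJ j h1 h2 (Submodule.subset_span (by simp))
  have hs : ∀ j : ℤ, 1 ≤ j → j < n → sS n A j ∈ V := fun j h1 h2 => hJ j h1 h2 (Submodule.subset_span (by simp))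
  rw [h.inv_A hn hm]
  refine V.smul_mem _ (V.sum_mem fun j hj => V.add_mem (V.smul_mem _ ?_) (V.smul_mem _ ?_))
  · rw [Finset.mem_range] at hj
    rcases Nat.eq_zero_or_pos j with rfl | h0
    · exact hK (Submodule.subset_span (by simp))
    rcases lt_trichotomy j n with h1 | rfl | h1
    · exact hc j (by omega) (by omega)
    · exact hK (Submodule.subset_span (by simp))
    · rw [← cS_refl hn]; exact hc _ (by omega) (by omega)
  · rw [Finset.mem_range] at hj
    rcases Nat.eq_zero_or_pos j with rfl | h0
    · simp [sS, th]
    rcases lt_trichotomy j n with h1 | rfl | h1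
    · exact hs j (by omega) (by omega)
    · have : sS j A j = 0 := by
        unfold sS; refine Finset.sum_eq_zero fun k _ => ?_
        rw [sin_th_n hn, zero_smul]
      rw [this]; exact V.zero_mem
    · rw [← neg_neg (sS n A j), ← sS_refl hn]; exact V.neg_mem (hs _ (by omega) (by omega))

lemma DD_le (h : Ons n A G) (hn : 0 < n) (V : Submodule ℝ L) (hK : KK n A ≤ V)
    (hJ : ∀ j : ℤ, 1 ≤ j → j < n → JJ n A G j ≤ V) : (DD A).toSubmodule ≤ V := by
  let W : Submodule ℝ L := KK n A ⊔ ⨆ j : Set.Ico (1:ℤ) n, JJ n A G j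
  have hKW : KK n A ≤ W := le_sup_left
  have hJW : ∀ j : ℤ, 1 ≤ j → j < n → JJ n A G j ≤ W := fun j h1 h2 =>
    (le_iSup (fun j : Set.Ico (1:ℤ) n => JJ n A G j) ⟨j, h1, h2⟩).trans le_sup_right
  have hWV : W ≤ V := sup_le hK (iSup_le fun j => hJ j j.2.1 j.2.2)
  refine le_trans (lieSpan_le_sub ?_ ?_) hWV
  · rintro x (rfl | rfl)
    · exact h.A_in hn W hKW hJW (m := 1) (by omega)
    · exact W.neg_mem (h.A_in hn W hKW hJW (m := 0) (by omega))
  · intro x hx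
    have : W ≤ W.comap (LieAlgebra.ad ℝ L x) := by
      refine sup_le ?_ (iSup_le fun j => ?_)
      · intro k hk
        rw [Submodule.mem_comap]
        have := h.KK_central hn k hk x (LieSubalgebra.subset_lieSpan hx)
        rw [← lie_skew, neg_eq_zero] at this
        change ⁅x, k⁆ ∈ W
        rw [this]; exact W.zero_mem
      · intro y hy
        exact hJW j j.2.1 j.2.2 (h.JJ_gen hn j x hx y hy)
    exact fun y hy => this hy

lemma half_sum {V : Type*} [AddCommGroup V] (hn : 0 < n) (f : ℤ → V) (hf : ∀ k, f (k + (2 * n : ℕ)) = f k)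
    (h0 : f 0 = 0) (h1 : f n = 0) :
    ∑ k ∈ Finset.range (2 * n), f k = ∑ k ∈ Finset.range (n - 1), (f (k + 1) + f (-(k + 1))) := by
  obtain ⟨m, rfl⟩ : ∃ m, n = m + 1 := ⟨n - 1, by omega⟩
  rw [Nat.add_sub_cancel, Finset.sum_add_distrib, two_mul, Finset.sum_range_add, Finset.sum_range_succ',
    Finset.sum_range_succ', ← Finset.sum_range_reflect (fun k : ℕ => f (-((k:ℤ) + 1)))]
  have e0 : f ((0:ℕ):ℤ) = 0 := by simpa using h0
  have e1 : f ((m + 1 + 0 : ℕ) : ℤ) = 0 := by simpa using h1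
  rw [e0, e1, add_zero, add_zero]
  congr 1
  · refine Finset.sum_congr rfl fun k hk => ?_
    rw [Finset.mem_range] at hk
    rw [← hf (-(((m - 1 - k : ℕ) : ℤ) + 1))]
    congr 1; omega

lemma sin_aSeq (n j k : ℕ) : Real.sin (((k:ℤ) + 1 : ℤ) * th n j) = aSeq (rt n j) k * Real.sin (th n j) := by
  have := aSeq_sin (th n j) k
  have e : rt n j = 2 * Real.cos (th n j) := by unfold rt th; push_cast; rfl
  rw [e, this]; push_cast; rfl

lemma half_gen (hn : 0 < n) (F : ℤ → L) (hF : ∀ m : ℤ, F (m + (2 * n : ℕ)) = F m) (j : ℕ) (a : ℤ) :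
    ∑ k ∈ Finset.range (2 * n), Real.sin ((k:ℤ) * th n j) • F (a + k) =
      Real.sin (th n j) • ∑ k ∈ Finset.range (n - 1), aSeq (rt n j) k • (F (a + (k + 1)) - F (a - (k + 1))) := by
  have := half_sum hn (fun k : ℤ => Real.sin (k * th n j) • F (a + k)) (by
    intro k; rw [sin_per hn, ← add_assoc, hF]) (by simp) (by
    have : ((n:ℤ):ℝ) * th n j = (j:ℤ) * Real.pi := by
      have hn' : (n:ℝ) ≠ 0 := by exact_mod_cast hn.ne'
      unfold th; push_cast; field_simp
    rw [this, Real.sin_int_mul_pi, zero_smul])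
  rw [this, Finset.smul_sum]
  refine Finset.sum_congr rfl fun k _ => ?_
  rw [Int.cast_neg, neg_mul, Real.sin_neg, sin_aSeq, sub_eq_add_neg a]; module

lemma hats_span (h : Ons n A G) (hn : 0 < n) {j : ℕ} (hj : 1 ≤ j) (hj' : j < n) (x y z : L)
    (hx : x = ∑ k ∈ Finset.range (n - 1), aSeq (rt n j) k • (A (1 + (k + 1)) - A (1 - (k + 1))))
    (hy : y = ∑ k ∈ Finset.range (n - 1), aSeq (rt n j) k • (A (0 - (k + 1)) - A (0 + (k + 1))))
    (hz : z = ∑ k ∈ Finset.range (n - 1), aSeq (rt n j) k • G (k + 1)) :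
    Submodule.span ℝ {x, y, z} = JJ n A G j ∧ sS n G j = (2 * Real.sin (th n j)) • z := by
  have hn' : (n:ℝ) ≠ 0 := by exact_mod_cast hn.ne'
  have hsin : Real.sin (th n j) ≠ 0 := by
    apply ne_of_gt
    apply Real.sin_pos_of_pos_of_lt_pi
    · unfold th; have := Real.pi_pos; push_cast
      have : (0:ℝ) < j := by exact_mod_cast hj
      have : (0:ℝ) < n := by exact_mod_cast hn
      positivity
    · unfold th; have := Real.pi_pos; push_cast
      have h2 : (0:ℝ) < n := by exact_mod_cast hn
      have h3 : (j:ℝ) < n := by exact_mod_cast hj'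
      rw [div_lt_iff₀ h2]; nlinarith
  set θ := th n j with hθ
  have e1 : Real.sin θ • x = Real.cos θ • sS n A j - Real.sin θ • cS n A j := by
    have e1 := half_gen hn A h.perA' j 1
    have e2 := sum_sin_shift' hn A h.perA' j 1
    rw [hx, ← e1, e2, Int.cast_one, one_mul]
  have e2 : Real.sin θ • y = - sS n A j := by
    have e1 := half_gen hn A h.perA' j 0
    have : y = - ∑ k ∈ Finset.range (n - 1), aSeq (rt n j) k • (A (0 + (k + 1)) - A (0 - (k + 1))) := by
      rw [hy, ← Finset.sum_neg_distrib]
      refine Finset.sum_congr rfl fun k _ => ?_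
      module
    rw [this, smul_neg, ← e1]; simp only [zero_add]; rfl
  have e3 : sS n G j = (2 * Real.sin θ) • z := by
    have e1 := half_gen hn G h.perG' j 0
    simp only [zero_add] at e1
    have e4 : ∑ k ∈ Finset.range (n - 1), aSeq (rt n j) k • (G (k + 1) - G (0 - (k + 1))) = (2:ℝ) • z := by
      rw [hz, Finset.smul_sum]
      refine Finset.sum_congr rfl fun k _ => ?_
      rw [zero_sub, h.odd]; module
    rw [sS, e1, e4]; module
  have x1 : x = (Real.cos θ / Real.sin θ) • sS n A j - cS n A j := by
    have : x = (Real.sin θ)⁻¹ • (Real.sin θ • x) := by rw [smul_smul, inv_mul_cancel₀ hsin, one_smul]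
    rw [this, e1, smul_sub, smul_smul, smul_smul, inv_mul_cancel₀ hsin, one_smul, mul_comm]; rfl
  have y1 : y = (-(Real.sin θ)⁻¹) • sS n A j := by
    have : y = (Real.sin θ)⁻¹ • (Real.sin θ • y) := by rw [smul_smul, inv_mul_cancel₀ hsin, one_smul]
    rw [this, e2]; module
  have z1 : z = (2 * Real.sin θ)⁻¹ • sS n G j := by
    rw [e3, smul_smul, inv_mul_cancel₀ (by simpa using hsin), one_smul]
  refine ⟨le_antisymm ?_ ?_, e3⟩
  · rw [Submodule.span_le]
    rintro w (hw | hw | hw)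
    · exact (Trip.mem_span _).mpr ⟨-1, Real.cos θ / Real.sin θ, 0, by rw [hw, x1]; module⟩
    · exact (Trip.mem_span _).mpr ⟨0, -(Real.sin θ)⁻¹, 0, by rw [hw, y1]; module⟩
    · exact (Trip.mem_span _).mpr ⟨0, 0, (2 * Real.sin θ)⁻¹, by rw [hw, z1]; module⟩
  · rw [Submodule.span_le]
    rintro w (hw | hw | hw)
    · refine (Trip.mem_span _).mpr ⟨-1, -Real.cos θ, 0, ?_⟩
      have : sS n A j = -(Real.sin θ • y) := by rw [e2]; module
      rw [hw, x1, y1, smul_smul, neg_mul_neg, div_eq_mul_inv]; module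
    · exact (Trip.mem_span _).mpr ⟨0, -Real.sin θ, 0, by rw [hw]; linear_combination (norm := module) (1:ℝ) • e2⟩
    · exact (Trip.mem_span _).mpr ⟨0, 0, 2 * Real.sin θ, by rw [hw, e3]; module⟩

end Ons


/-- chain of anticommuting neighbours on a cycle of length `2 n` -/
structure Chain {R : Type*} [Ring R] (n : ℕ) (e : ℤ → R) : Prop where
  per : ∀ i, e (i + 2 * n) = e i
  sq : ∀ i, e i * e i = 1
  anti : ∀ i, e i * e (i + 1) = - (e (i + 1) * e i)
  comm : ∀ (i k : ℤ), 2 ≤ k → k ≤ 2 * n - 2 → e i * e (i + k) = e (i + k) * e i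

section words
set_option linter.unusedSectionVars false
variable {R : Type*} [Ring R] [Algebra ℝ R] {n : ℕ} {e : ℤ → R}

/-- the word `e_i e_{i+1} ⋯ e_{i+k-1}` -/
def wd (e : ℤ → R) (i : ℤ) : ℕ → R
  | 0 => 1
  | k + 1 => wd e i k * e (i + k)

lemma wd_left (e : ℤ → R) (i : ℤ) (k : ℕ) : wd e i (k + 1) = e i * wd e (i + 1) k := by
  induction k with
  | zero => simp [wd]
  | succ k ih =>
    rw [wd, ih, wd, mul_assoc]; congr 3; push_cast; ring

/-- sum of words over the sites -/
def Wd (n : ℕ) (e : ℤ → R) (p : ℤ) (k : ℕ) : R := ∑ j ∈ Finset.range n, wd e (2 * j + p) k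

/-- parity indicator -/
def par (j : ℤ) : ℝ := if Even j then 1 else 0

lemma par_even {j : ℤ} (h : Even j) : par j = 1 := if_pos h
lemma par_odd {j : ℤ} (h : ¬ Even j) : par j = 0 := if_neg h
lemma par_congr {j k : ℤ} (h : Even (j - k)) : par j = par k := by
  unfold par
  congr 1
  rw [Int.even_sub] at h
  exact propext h

namespace Chain

lemma wd_per (h : Chain n e) (i : ℤ) (k : ℕ) : wd e (i + 2 * n) k = wd e i k := by
  induction k with
  | zero => rfl
  | succ k ih => rw [wd, wd, ih, ← h.per (i + k)]; congr 2; ring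

lemma Wd_shift (h : Chain n e) (p : ℤ) (k : ℕ) : Wd n e (p + 2) k = Wd n e p k := by
  have := sum_shift n (fun j : ℤ => wd e (2 * j + p) k) (by
    intro j
    rw [← h.wd_per (2 * j + p)]; congr 1; ring) 1
  rw [Wd, Wd, ← this]
  refine Finset.sum_congr rfl fun j _ => ?_
  congr 1; ring

lemma Wd_par (h : Chain n e) (p : ℤ) (l : ℤ) (k : ℕ) : Wd n e (p + 2 * l) k = Wd n e p k := by
  induction l using Int.induction_on with
  | zero => simp
  | succ i ih => rw [← ih, ← h.Wd_shift (p + 2 * (i:ℤ))]; congr 1; ring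
  | pred i ih => rw [← ih, ← h.Wd_shift (p + 2 * (-(i:ℤ) - 1))]; congr 1; ring

lemma comm' (h : Chain n e) (i k : ℤ) (h1 : 2 ≤ k) (h2 : k ≤ 2 * n - 2) : e i * e (i + k) - e (i + k) * e i = 0 := by
  rw [h.comm i k h1 h2, sub_self]

lemma E_letter (h : Chain n e) (hn : 2 ≤ n) (q i : ℤ) :
    Wd n e q 1 * e i - e i * Wd n e q 1 =
      (2 * par (i - 1 - q)) • (e (i - 1) * e i) - (2 * par (i + 1 - q)) • (e i * e (i + 1)) := by
  rcases Int.even_or_odd (i - q) with ⟨a, ha⟩ | ⟨a, ha⟩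
  · rw [par_odd (by rw [Int.not_even_iff_odd]; exact ⟨a - 1, by omega⟩),
      par_odd (by rw [Int.not_even_iff_odd]; exact ⟨a, by omega⟩)]
    have e1 : Wd n e q 1 = Wd n e i 1 := by
      rw [← h.Wd_par q a]; congr 1; omega
    rw [e1, Wd, Finset.sum_mul, Finset.mul_sum, ← Finset.sum_sub_distrib]
    simp only [mul_zero, zero_smul, sub_zero]
    refine Finset.sum_eq_zero fun j hj => ?_
    rw [Finset.mem_range] at hj
    simp only [wd, one_mul, Nat.cast_zero, add_zero]
    rcases Nat.eq_zero_or_pos j with rfl | hj0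
    · simp
    · have := h.comm' i (2 * j) (by omega) (by omega)
      rw [show 2 * (j:ℤ) + i = i + 2 * j by ring, ← neg_sub, this, neg_zero]
  · rw [par_even ⟨a, by omega⟩, par_even ⟨a + 1, by omega⟩]
    have e1 : Wd n e q 1 = Wd n e (i - 1) 1 := by
      rw [← h.Wd_par q a]; congr 1; omega
    obtain ⟨m, rfl⟩ : ∃ m, n = m + 2 := ⟨n - 2, by omega⟩
    have a1 := h.anti (i - 1)
    have a2 := h.anti i
    rw [sub_add_cancel] at a1
    rw [e1, Wd, Finset.sum_mul, Finset.mul_sum, ← Finset.sum_sub_distrib, Finset.sum_range_succ',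
      Finset.sum_range_succ', Finset.sum_eq_zero]
    · simp only [wd, one_mul, Nat.cast_zero, add_zero, mul_zero, zero_add, Nat.cast_one, mul_one]
      rw [show (2:ℤ) + (i - 1) = i + 1 by ring]
      have a3 : e i * e (i - 1) = - (e (i - 1) * e i) := by rw [a1, neg_neg]
      have a4 : e (i + 1) * e i = - (e i * e (i + 1)) := by rw [a2, neg_neg]
      rw [a3, a4]; module
    · intro j hj
      rw [Finset.mem_range] at hj
      simp only [wd, one_mul, Nat.cast_zero, add_zero]
      have := h.comm' i (2 * j + 3) (by omega) (by push_cast; omega)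
      rw [show 2 * (((j + 1 + 1 : ℕ)):ℤ) + (i - 1) = i + (2 * j + 3) by push_cast; ring, ← neg_sub, this, neg_zero]

lemma E_word (h : Chain n e) (hn : 2 ≤ n) (q i : ℤ) (k : ℕ) :
    Wd n e q 1 * wd e i (k + 1) - wd e i (k + 1) * Wd n e q 1 =
      (2 * par (i - 1 - q)) • wd e (i - 1) (k + 2) + (2 * par (i - q)) • wd e (i + 1) k
      - (2 * par (i + k + 1 - q)) • wd e i (k + 2) - (2 * par (i + k - q)) • wd e i k := by
  induction k with
  | zero =>
    have := h.E_letter hn q i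
    simp only [wd, one_mul, Nat.cast_zero, add_zero, zero_add, Nat.cast_one] at this ⊢
    rw [this, sub_add_cancel]; module
  | succ k ih =>
    set E := Wd n e q 1 with hE
    have e1 : wd e i (k + 2) * e (i + k + 1) = wd e i (k + 1) * (e (i + k + 1) * e (i + k + 1)) := by
      rw [wd, mul_assoc]; push_cast; rw [← add_assoc]
    have el := h.E_letter hn q (i + k + 1)
    rw [← hE, show i + (k:ℤ) + 1 - 1 = i + k by ring] at el
    have w1 : wd e i (k + 1 + 1) = wd e i (k + 1) * e (i + k + 1) := by
      rw [wd]; push_cast; rw [← add_assoc]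
    have w2 : wd e (i - 1) (k + 1 + 2) = wd e (i - 1) (k + 2) * e (i + k + 1) := by
      rw [wd]; congr 2; push_cast; ring
    have w3 : wd e (i + 1) (k + 1) = wd e (i + 1) k * e (i + k + 1) := by
      rw [wd]; congr 2; ring
    have w4 : wd e i (k + 1 + 2) = wd e i (k + 1) * e (i + k + 1) * e (i + k + 1 + 1) := by
      rw [← w1, wd]; congr 2; push_cast; ring
    have w5 : wd e i (k + 1) = wd e i k * e (i + k) := rfl
    have s1 := h.sq (i + k + 1)
    have s2 := h.sq (i + k)
    have key : E * wd e i (k + 1 + 1) - wd e i (k + 1 + 1) * E =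
        (E * wd e i (k + 1) - wd e i (k + 1) * E) * e (i + k + 1)
        + wd e i (k + 1) * (E * e (i + k + 1) - e (i + k + 1) * E) := by
      rw [w1]; noncomm_ring
    rw [key, ih, el, w2, w3, w4]
    have u1 : wd e i (k + 2) * e (i + k + 1) = wd e i (k + 1) := by rw [e1, s1, mul_one]
    have u2 : wd e i (k + 1) * (e (i + k) * e (i + k + 1)) = wd e i k * e (i + k + 1) := by
      rw [w5, mul_assoc, ← mul_assoc (e (i + k)), s2, one_mul]
    have u3 : wd e i (k + 1) * (e (i + k + 1) * e (i + k + 1 + 1)) =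
      wd e i (k + 1) * e (i + k + 1) * e (i + k + 1 + 1) := by rw [mul_assoc]
    rw [sub_mul, sub_mul, add_mul, smul_mul_assoc, smul_mul_assoc, smul_mul_assoc, smul_mul_assoc,
      mul_sub, mul_smul_comm, mul_smul_comm, u1, u2, u3]
    push_cast
    rw [show i + ((k:ℤ) + 1) + 1 - q = i + k + 1 + 1 - q by ring,
      show i + ((k:ℤ) + 1) - q = i + k + 1 - q by ring]
    module

lemma E_Word (h : Chain n e) (hn : 2 ≤ n) (q p : ℤ) (k : ℕ) :
    Wd n e q 1 * Wd n e p (k + 1) - Wd n e p (k + 1) * Wd n e q 1 =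
      (2 * par (p - 1 - q)) • Wd n e (p - 1) (k + 2) + (2 * par (p - q)) • Wd n e (p + 1) k
      - (2 * par (p + k + 1 - q)) • Wd n e p (k + 2) - (2 * par (p + k - q)) • Wd n e p k := by
  have hp : ∀ (k : ℕ), Wd n e p k = ∑ j ∈ Finset.range n, wd e (2 * j + p) k := fun _ => rfl
  have hp' : ∀ (r : ℤ) (k : ℕ), Wd n e r k = ∑ j ∈ Finset.range n, wd e (2 * j + r) k := fun _ _ => rfl
  rw [hp (k+1), Finset.mul_sum, Finset.sum_mul, ← Finset.sum_sub_distrib]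
  rw [hp, hp, hp' (p - 1), hp' (p + 1)]
  simp only [Finset.smul_sum]
  rw [← Finset.sum_add_distrib, ← Finset.sum_sub_distrib, ← Finset.sum_sub_distrib]
  refine Finset.sum_congr rfl fun j _ => ?_
  have := h.E_word hn q (2 * j + p) k
  rw [this]
  rw [par_congr (j := 2 * j + p - 1 - q) (k := p - 1 - q) ⟨j, by ring⟩,
    par_congr (j := 2 * j + p - q) (k := p - q) ⟨j, by ring⟩,
    par_congr (j := 2 * j + p + k + 1 - q) (k := p + k + 1 - q) ⟨j, by ring⟩,
    par_congr (j := 2 * j + p + k - q) (k := p + k - q) ⟨j, by ring⟩,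
    show 2 * (j:ℤ) + p - 1 = 2 * j + (p - 1) by ring, show 2 * (j:ℤ) + p + 1 = 2 * j + (p + 1) by ring]

lemma wd_comm (h : Chain n e) (i : ℤ) (k : ℕ) (hk : k + 3 ≤ 2 * n) :
    e i * wd e (i + 2) k = wd e (i + 2) k * e i := by
  induction k with
  | zero => simp [wd]
  | succ k ih =>
    rw [wd, ← mul_assoc, ih (by omega), mul_assoc, mul_assoc]
    have := h.comm i (2 + k) (by omega) (by omega)
    rw [← add_assoc] at this
    rw [this]

lemma wd_loop (h : Chain n e) (hn : 2 ≤ n) (i : ℤ) : wd e i (2 * n + 1) = wd e (i + 1) (2 * n - 1) := by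
  obtain ⟨m, hm⟩ : ∃ m, 2 * n = m + 3 := ⟨2 * n - 3, by omega⟩
  rw [wd_left, hm, show m + 3 - 1 = m + 1 + 1 by omega, show m + 3 = m + 1 + 1 + 1 by rfl]
  have e0 : e (i + 1 + (m + 1 + 1 : ℕ)) = e i := by
    rw [← h.per i]; congr 1; push_cast; have : (2 * n : ℤ) = m + 3 := by exact_mod_cast hm
    omega
  have e1 : e i * wd e (i + 1) (m + 1 + 1) = wd e (i + 1) (m + 1 + 1) * e i := by
    rw [wd_left, wd, show i + 1 + 1 = i + 2 by ring]
    have c1 := h.wd_comm i m (by omega)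
    have c2 := h.anti i
    have c3 := h.anti (i + 2 + m)
    have e3 : e (i + 2 + m + 1) = e i := by
      rw [← h.per i]; congr 1; have : (2 * n : ℤ) = m + 3 := by exact_mod_cast hm
      omega
    rw [e3] at c3
    calc e i * (e (i + 1) * (wd e (i + 2) m * e (i + 2 + m)))
        = (e i * e (i + 1)) * wd e (i + 2) m * e (i + 2 + m) := by noncomm_ring
      _ = - (e (i + 1) * (e i * wd e (i + 2) m) * e (i + 2 + m)) := by rw [c2]; noncomm_ring
      _ = e (i + 1) * (wd e (i + 2) m * -(e i * e (i + 2 + m))) := by rw [c1]; noncomm_ring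
      _ = e (i + 1) * (wd e (i + 2) m * e (i + 2 + m)) * e i := by rw [← c3]; noncomm_ring
  rw [show wd e (i + 1) (m + 1 + 1 + 1) = wd e (i + 1) (m + 1 + 1) * e (i + 1 + (m + 1 + 1 : ℕ)) from rfl,
    e0, ← mul_assoc, e1, mul_assoc, h.sq, mul_one]

lemma Wd_loop (h : Chain n e) (hn : 2 ≤ n) (p : ℤ) : Wd n e p (2 * n + 1) = Wd n e (p + 1) (2 * n - 1) := by
  unfold Wd
  refine Finset.sum_congr rfl fun j _ => ?_
  rw [h.wd_loop hn, add_assoc]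

end Chain
end words


section onsager
variable {n : ℕ} {e : ℤ → M n}

/-- the operators `G_m`, `m ≥ 0` -/
def gN (n : ℕ) (e : ℤ → M n) (m : ℕ) : M n := (-(-1) ^ m : ℂ) • (Wd n e 0 (2 * m) - Wd n e 1 (2 * m))

/-- the operators `A_m` -/
def oA (n : ℕ) (e : ℤ → M n) (m : ℤ) : M n :=
  if 0 < m then ((-1) ^ (m - 1).toNat * Complex.I : ℂ) • Wd n e 1 (2 * (m - 1).toNat + 1)
  else (-((-1) ^ (-m).toNat * Complex.I) : ℂ) • Wd n e 0 (2 * (-m).toNat + 1)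

/-- the operators `G_m` -/
def oG (n : ℕ) (e : ℤ → M n) (m : ℤ) : M n :=
  if 0 < m then gN n e m.toNat else - gN n e (-m).toNat

lemma oA_pos (m : ℕ) : oA n e (m + 1) = ((-1) ^ m * Complex.I : ℂ) • Wd n e 1 (2 * m + 1) := by
  rw [oA, if_pos (by omega)]; simp
lemma oA_neg (m : ℕ) : oA n e (-m) = (-((-1) ^ m * Complex.I) : ℂ) • Wd n e 0 (2 * m + 1) := by
  rw [oA, if_neg (by omega)]; simp
lemma gN_zero : gN n e 0 = 0 := by
  simp [gN, Wd, wd]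
lemma oG_nat (m : ℕ) : oG n e m = gN n e m := by
  rcases Nat.eq_zero_or_pos m with rfl | h
  · simp [oG, gN_zero]
  · rw [oG, if_pos (by omega)]; simp
lemma oG_neg (m : ℕ) : oG n e (-m) = - gN n e m := by
  rw [oG, if_neg (by omega)]; simp
lemma oA_zero : oA n e 0 = (-Complex.I) • Wd n e 0 1 := by
  have := oA_neg (n := n) (e := e) 0
  simpa using this
lemma oA_one : oA n e 1 = Complex.I • Wd n e 1 1 := by
  have := oA_pos (n := n) (e := e) 0
  simpa using this

lemma int_cases (m : ℤ) : (∃ k : ℕ, m = k + 1) ∨ ∃ k : ℕ, m = -k := by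
  rcases lt_or_ge 0 m with h | h
  · exact Or.inl ⟨(m - 1).toNat, by omega⟩
  · exact Or.inr ⟨(-m).toNat, by omega⟩

lemma oG_odd (m : ℤ) : oG n e (-m) = - oG n e m := by
  rcases int_cases m with ⟨k, rfl⟩ | ⟨k, rfl⟩
  · have := oG_neg (n := n) (e := e) (k + 1)
    have h2 := oG_nat (n := n) (e := e) (k + 1)
    push_cast at this h2
    rw [this, h2]
  · rw [neg_neg, oG_nat, oG_neg, neg_neg]

lemma lie_ss (a b : ℂ) (x y : M n) : ⁅a • x, b • y⁆ = (a * b) • (x * y - y * x) := by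
  rw [Ring.lie_def, smul_mul_smul_comm, smul_mul_smul_comm, mul_comm b a, smul_sub]

lemma r2c (x : M n) : (2:ℝ) • x = (2:ℂ) • x := by
  rw [two_smul, two_smul]

lemma E_ee (h : Chain n e) (hn : 2 ≤ n) (q p : ℤ) (k : ℕ) (h1 : Even (p - q)) (h2 : Even (k:ℤ)) :
    Wd n e q 1 * Wd n e p (k + 1) - Wd n e p (k + 1) * Wd n e q 1 =
      (2:ℂ) • (Wd n e (p + 1) k - Wd n e p k) := by
  have := h.E_Word hn q p k
  rw [Int.even_iff] at h1 h2
  rw [par_odd (j := p - 1 - q) (by rw [Int.even_iff]; omega), par_even (j := p - q) (by rw [Int.even_iff]; omega),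
    par_odd (j := p + k + 1 - q) (by rw [Int.even_iff]; omega),
    par_even (j := p + k - q) (by rw [Int.even_iff]; omega)] at this
  rw [this, ← r2c]; module

lemma E_oe (h : Chain n e) (hn : 2 ≤ n) (q p : ℤ) (k : ℕ) (h1 : Odd (p - q)) (h2 : Even (k:ℤ)) :
    Wd n e q 1 * Wd n e p (k + 1) - Wd n e p (k + 1) * Wd n e q 1 =
      (2:ℂ) • (Wd n e (p - 1) (k + 2) - Wd n e p (k + 2)) := by
  have := h.E_Word hn q p k
  rw [Int.even_iff] at h2
  rw [Int.odd_iff] at h1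
  rw [par_even (j := p - 1 - q) (by rw [Int.even_iff]; omega), par_odd (j := p - q) (by rw [Int.even_iff]; omega),
    par_even (j := p + k + 1 - q) (by rw [Int.even_iff]; omega),
    par_odd (j := p + k - q) (by rw [Int.even_iff]; omega)] at this
  rw [this, ← r2c]; module

lemma E_eo (h : Chain n e) (hn : 2 ≤ n) (q p : ℤ) (k : ℕ) (h1 : Even (p - q)) (h2 : Odd (k:ℤ)) :
    Wd n e q 1 * Wd n e p (k + 1) - Wd n e p (k + 1) * Wd n e q 1 =
      (2:ℂ) • (Wd n e (p + 1) k - Wd n e p (k + 2)) := by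
  have := h.E_Word hn q p k
  rw [Int.even_iff] at h1
  rw [Int.odd_iff] at h2
  rw [par_odd (j := p - 1 - q) (by rw [Int.even_iff]; omega), par_even (j := p - q) (by rw [Int.even_iff]; omega),
    par_even (j := p + k + 1 - q) (by rw [Int.even_iff]; omega),
    par_odd (j := p + k - q) (by rw [Int.even_iff]; omega)] at this
  rw [this, ← r2c]; module

lemma E_oo (h : Chain n e) (hn : 2 ≤ n) (q p : ℤ) (k : ℕ) (h1 : Odd (p - q)) (h2 : Odd (k:ℤ)) :
    Wd n e q 1 * Wd n e p (k + 1) - Wd n e p (k + 1) * Wd n e q 1 =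
      (2:ℂ) • (Wd n e (p - 1) (k + 2) - Wd n e p k) := by
  have := h.E_Word hn q p k
  rw [Int.odd_iff] at h1 h2
  rw [par_even (j := p - 1 - q) (by rw [Int.even_iff]; omega), par_odd (j := p - q) (by rw [Int.even_iff]; omega),
    par_odd (j := p + k + 1 - q) (by rw [Int.even_iff]; omega),
    par_even (j := p + k - q) (by rw [Int.even_iff]; omega)] at this
  rw [this, ← r2c]; module

lemma ev2 (k : ℕ) : Even (((2 * k : ℕ)):ℤ) := ⟨k, by push_cast; ring⟩
lemma od2 (k : ℕ) : Odd (((2 * k + 1 : ℕ)):ℤ) := ⟨k, by push_cast; ring⟩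

lemma rc (r : ℝ) (x : M n) : r • x = (r : ℂ) • x := by
  ext i j; simp

lemma ons_h0 (h : Chain n e) (hn : 2 ≤ n) (m : ℤ) : ⁅oA n e 0, oA n e m⁆ = (2:ℝ) • oG n e m := by
  have hI : Complex.I * Complex.I = -1 := Complex.I_mul_I
  rcases int_cases m with ⟨k, rfl⟩ | ⟨k, rfl⟩
  · have h2 := oG_nat (n := n) (e := e) (k + 1)
    push_cast at h2
    rw [oA_zero, oA_pos, lie_ss, E_oe h hn 0 1 (2 * k) ⟨0, by norm_num⟩ (ev2 k), h2, gN, rc, sub_self,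
      smul_smul, smul_smul]
    congr 1
    push_cast; linear_combination (-2 * (-1) ^ k) * hI
  · rw [oA_zero, oA_neg, lie_ss, E_ee h hn 0 0 (2 * k) ⟨0, by norm_num⟩ (ev2 k), oG_neg, gN, rc, zero_add,
      ← smul_neg, neg_sub, smul_smul, smul_smul]
    congr 1
    push_cast; linear_combination (2 * (-1) ^ k) * hI

lemma ons_h1 (h : Chain n e) (hn : 2 ≤ n) (m : ℤ) : ⁅oA n e 1, oA n e m⁆ = (2:ℝ) • oG n e (m - 1) := by
  have hI : Complex.I * Complex.I = -1 := Complex.I_mul_I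
  rcases int_cases m with ⟨k, rfl⟩ | ⟨k, rfl⟩
  · rw [oA_one, oA_pos, lie_ss, E_ee h hn 1 1 (2 * k) ⟨0, by norm_num⟩ (ev2 k), add_sub_cancel_right,
      oG_nat, gN, rc, show (1:ℤ) + 1 = 0 + 2 by norm_num, h.Wd_shift, smul_smul, smul_smul]
    congr 1
    push_cast; linear_combination (2 * (-1) ^ k) * hI
  · have h2 := oG_neg (n := n) (e := e) (k + 1)
    push_cast at h2
    rw [oA_one, oA_neg, lie_ss, E_oe h hn 1 0 (2 * k) ⟨-1, by norm_num⟩ (ev2 k),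
      show -(k:ℤ) - 1 = -(k + 1) by ring, h2, gN, rc, ← h.Wd_shift (0 - 1),
      show (0:ℤ) - 1 + 2 = 1 by norm_num, ← smul_neg, neg_sub, smul_smul, smul_smul]
    congr 1
    push_cast; linear_combination (-2 * (-1) ^ k) * hI

lemma gN_succ (k : ℕ) : gN n e (k + 1) = ((-1) ^ k : ℂ) • Wd n e 0 (2 * k + 1 + 1) - ((-1) ^ k : ℂ) • Wd n e 1 (2 * k + 1 + 1) := by
  rw [gN, ← smul_sub, pow_succ]; congr 1; ring

lemma oA_neg1 (k : ℕ) : oA n e (-(k + 1)) = ((-1) ^ k * Complex.I : ℂ) • Wd n e 0 (2 * k + 1 + 2) := by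
  have := oA_neg (n := n) (e := e) (k + 1)
  push_cast at this
  rw [this, pow_succ]; congr 1; ring

lemma ons_h2 (h : Chain n e) (hn : 2 ≤ n) (m : ℤ) :
    ⁅oA n e 0, oG n e m⁆ = (-4:ℝ) • (oA n e m - oA n e (-m)) := by
  have key : ∀ k : ℕ, ⁅oA n e 0, oG n e k⁆ = (-4:ℝ) • (oA n e k - oA n e (-k)) := by
    intro k
    cases k with
    | zero => rw [oG_nat, gN_zero]; simp
    | succ k =>
      rw [oG_nat, gN_succ, lie_sub, oA_zero, lie_ss, lie_ss,
        E_eo h hn 0 0 (2 * k + 1) ⟨0, by norm_num⟩ (od2 k), E_oo h hn 0 1 (2 * k + 1) ⟨0, by norm_num⟩ (od2 k)]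
      push_cast
      rw [oA_pos, oA_neg1, rc]
      push_cast
      module
  rcases int_cases m with ⟨k, rfl⟩ | ⟨k, rfl⟩
  · have := key (k + 1)
    push_cast at this; exact this
  · have := key k
    rw [oG_odd, lie_neg, this, neg_neg]; module

lemma ons_h3 (h : Chain n e) (hn : 2 ≤ n) (m : ℤ) :
    ⁅oA n e 1, oG n e m⁆ = (-4:ℝ) • (oA n e (1 + m) - oA n e (1 - m)) := by
  have key : ∀ k : ℕ, ⁅oA n e 1, oG n e k⁆ = (-4:ℝ) • (oA n e (1 + k) - oA n e (1 - k)) := by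
    intro k
    cases k with
    | zero => rw [oG_nat, gN_zero]; simp
    | succ k =>
      have e1 := oA_pos (n := n) (e := e) (k + 1)
      push_cast at e1
      rw [oG_nat, gN_succ, lie_sub, oA_one, lie_ss, lie_ss,
        E_oo h hn 1 0 (2 * k + 1) ⟨-1, by norm_num⟩ (od2 k), E_eo h hn 1 1 (2 * k + 1) ⟨0, by norm_num⟩ (od2 k)]
      push_cast
      rw [show (1:ℤ) + (k + 1) = k + 1 + 1 by ring, e1, show (1:ℤ) - (k + 1) = -k by ring, oA_neg, rc,
        show (2:ℤ) = 0 + 2 by norm_num, h.Wd_shift, ← h.Wd_shift (-1), show (-1:ℤ) + 2 = 1 by norm_num,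
        pow_succ, show 2 * (k + 1) + 1 = 2 * k + 1 + 2 by ring]
      push_cast
      module
  rcases int_cases m with ⟨k, rfl⟩ | ⟨k, rfl⟩
  · have := key (k + 1)
    push_cast at this; exact this
  · have := key k
    rw [oG_odd, lie_neg, this, sub_neg_eq_add, ← sub_eq_add_neg]; module

lemma ons (h : Chain n e) (hn : 2 ≤ n) : Ons n (oA n e) (oG n e) where
  h0 := ons_h0 h hn
  h1 := ons_h1 h hn
  h2 := ons_h2 h hn
  h3 := ons_h3 h hn
  odd := oG_odd
  gl0 := by
    obtain ⟨m, rfl⟩ : ∃ m, n = m + 1 := ⟨n - 1, by omega⟩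
    have := h.Wd_loop hn 0
    rw [oA_neg, this, zero_add]
    push_cast
    rw [oA_pos, pow_succ, show 2 * (m + 1) - 1 = 2 * m + 1 by omega]
    congr 1; ring
  gl1 := by
    obtain ⟨m, rfl⟩ : ∃ m, n = m + 1 := ⟨n - 1, by omega⟩
    have := h.Wd_loop hn 1
    rw [oA_pos, this, show (1:ℤ) - ((m + 1 : ℕ):ℤ) = - m by push_cast; ring, oA_neg,
      show (1:ℤ) + 1 = 0 + 2 by norm_num, h.Wd_shift, pow_succ, show 2 * (m + 1) - 1 = 2 * m + 1 by omega]
    congr 1; ring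
end onsager


section concrete
variable {n : ℕ}

lemma kron_mul (f g : Fin n → Matrix (Fin 2) (Fin 2) ℂ) : kron f * kron g = kron (fun i => f i * g i) := by
  ext x y
  simp only [Matrix.mul_apply, kron, Finset.prod_univ_sum, Fintype.piFinset_univ, Finset.prod_mul_distrib]

lemma kron_one : kron (fun _ : Fin n => (1 : Matrix (Fin 2) (Fin 2) ℂ)) = 1 := by
  ext x y
  simp only [kron, Matrix.one_apply]
  by_cases h : x = y
  · subst h; simp
  · rw [if_neg h]
    obtain ⟨i, hi⟩ := Function.ne_iff.mp h
    exact Finset.prod_eq_zero (Finset.mem_univ i) (if_neg hi)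

/-- a Pauli string starting at site `j` -/
def kr (n : ℕ) (j : ℤ) (F : ℤ → Matrix (Fin 2) (Fin 2) ℂ) : M n :=
  kron fun i => F ((((i : ℕ) : ℤ) - j) % n)

lemma fin_emod (i : Fin n) (j : ℤ) : 0 ≤ (((i : ℕ) : ℤ) - j) % n ∧ (((i : ℕ) : ℤ) - j) % n < n := by
  have := i.2
  exact ⟨Int.emod_nonneg _ (by omega), Int.emod_lt_of_pos _ (by omega)⟩

lemma kr_congr (j : ℤ) {F F' : ℤ → Matrix (Fin 2) (Fin 2) ℂ} (h : ∀ t : ℤ, 0 ≤ t → t < n → F t = F' t) :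
    kr n j F = kr n j F' := by
  unfold kr; congr 1; funext i
  exact h _ (fin_emod i j).1 (fin_emod i j).2

/-- the site at offset `t` from `j` -/
lemma exists_site (j t : ℤ) (h0 : 0 ≤ t) (h1 : t < n) : ∃ i : Fin n, (((i : ℕ) : ℤ) - j) % n = t := by
  have hn : (n:ℤ) ≠ 0 := by omega
  have a1 := Int.emod_nonneg (j + t) hn
  have a2 := Int.emod_lt_of_pos (j + t) (show (0:ℤ) < n by omega)
  refine ⟨⟨((j + t) % n).toNat, by omega⟩, ?_⟩
  simp only [Int.toNat_of_nonneg a1]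
  rw [Int.emod_sub_emod, add_sub_cancel_left, Int.emod_eq_of_lt h0 h1]

lemma site_inj {j : ℤ} {i i' : Fin n} (h : (((i : ℕ) : ℤ) - j) % n = (((i' : ℕ) : ℤ) - j) % n) : i = i' := by
  have h1 : (((i : ℕ) : ℤ)) % n = (((i' : ℕ) : ℤ)) % n := by
    have := Int.emod_add_cancel_right (m := ((i : ℕ) : ℤ) - j) (n := n) (k := ((i' : ℕ) : ℤ) - j) j
    simp only [sub_add_cancel] at this
    exact this.mpr h
  rw [Int.emod_eq_of_lt (by omega) (by omega), Int.emod_eq_of_lt (by omega) (by omega)] at h1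
  exact Fin.ext (by exact_mod_cast h1)

lemma kr_smul (j : ℤ) {F F' : ℤ → Matrix (Fin 2) (Fin 2) ℂ} (c : ℂ) (t0 : ℤ) (h0 : 0 ≤ t0) (h1 : t0 < n)
    (hF : F t0 = c • F' t0) (h : ∀ t : ℤ, 0 ≤ t → t < n → t ≠ t0 → F t = F' t) :
    kr n j F = c • kr n j F' := by
  obtain ⟨i0, hi0⟩ := exists_site j t0 h0 h1
  ext x y
  simp only [kr, kron, Matrix.smul_apply]
  rw [← Finset.mul_prod_erase _ _ (Finset.mem_univ i0), ← Finset.mul_prod_erase Finset.univ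
    (fun i : Fin n => F' ((((i : ℕ) : ℤ) - j) % n) (x i) (y i)) (Finset.mem_univ i0), hi0, hF, Matrix.smul_apply,
    smul_eq_mul, smul_eq_mul, mul_assoc]
  congr 2
  refine Finset.prod_congr rfl fun i hi => ?_
  rw [h _ (fin_emod i j).1 (fin_emod i j).2]
  intro hh
  rw [← hi0] at hh
  exact (Finset.mem_erase.mp hi).1 (site_inj hh)

lemma kr_per (j : ℤ) (F : ℤ → Matrix (Fin 2) (Fin 2) ℂ) : kr n (j + n) F = kr n j F := by
  unfold kr; congr 1; funext i
  rw [← sub_sub, Int.sub_emod_right]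

/-- a Pauli matrix at a site -/
def op (n : ℕ) (σ : Matrix (Fin 2) (Fin 2) ℂ) (j : ℤ) : M n := kr n j (fun t => if t = 0 then σ else 1)

lemma op_per (σ : Matrix (Fin 2) (Fin 2) ℂ) (j : ℤ) : op n σ (j + n) = op n σ j := kr_per j _

lemma off_iff (a m : ℤ) (h0 : 0 ≤ m) (h1 : m < n) : (a - m) % n = 0 ↔ a % n = m := by
  rw [← Int.emod_eq_emod_iff_emod_sub_eq_zero, Int.emod_eq_of_lt h0 h1]

lemma kr_mul_op (j m : ℤ) (h0 : 0 ≤ m) (h1 : m < n) (F : ℤ → Matrix (Fin 2) (Fin 2) ℂ)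
    (σ : Matrix (Fin 2) (Fin 2) ℂ) :
    kr n j F * op n σ (j + m) = kr n j (fun t => if t = m then F t * σ else F t) := by
  rw [op, kr, kr, kr, kron_mul]
  congr 1; funext i
  have := off_iff (((i:ℕ):ℤ) - j) m h0 h1
  rw [sub_sub] at this
  simp only [this]
  split_ifs
  · rfl
  · rw [mul_one]

lemma op_mul_kr (j m : ℤ) (h0 : 0 ≤ m) (h1 : m < n) (F : ℤ → Matrix (Fin 2) (Fin 2) ℂ)
    (σ : Matrix (Fin 2) (Fin 2) ℂ) :
    op n σ (j + m) * kr n j F = kr n j (fun t => if t = m then σ * F t else F t) := by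
  rw [op, kr, kr, kr, kron_mul]
  congr 1; funext i
  have := off_iff (((i:ℕ):ℤ) - j) m h0 h1
  rw [sub_sub] at this
  simp only [this]
  split_ifs
  · rfl
  · rw [one_mul]

lemma op_mul (σ τ : Matrix (Fin 2) (Fin 2) ℂ) (j : ℤ) : op n σ j * op n τ j = op n (σ * τ) j := by
  rw [op, op, op, kr, kr, kr, kron_mul]
  congr 1; funext i
  split_ifs <;> simp

lemma op_one (j : ℤ) : op n 1 j = 1 := by
  rw [op, kr, ← kron_one]; simp

lemma op_neg (hn : 0 < n) (σ : Matrix (Fin 2) (Fin 2) ℂ) (j : ℤ) : op n (-σ) j = - op n σ j := by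
  have := kr_smul (n := n) j (F := fun t => if t = 0 then -σ else 1) (F' := fun t => if t = 0 then σ else 1) (-1) 0
    le_rfl (by omega) (by simp) (by intro t _ _ ht; simp [ht])
  rw [op, this, op, neg_one_smul]

lemma op_comm (σ τ : Matrix (Fin 2) (Fin 2) ℂ) (i j : ℤ) (h : Commute σ τ ∨ ¬ (n:ℤ) ∣ (j - i)) :
    Commute (op n σ i) (op n τ j) := by
  unfold Commute SemiconjBy
  rw [op, op, kr, kr, kron_mul, kron_mul]
  congr 1; funext s
  split_ifs with h1 h2
  · rcases h with h | h
    · exact h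
    · exfalso; apply h
      have d1 := Int.dvd_of_emod_eq_zero h1
      have d2 := Int.dvd_of_emod_eq_zero h2
      have := dvd_sub d1 d2
      rwa [sub_sub_sub_cancel_left] at this
  · simp
  · simp
  · simp

lemma ndvd' {x : ℤ} (h0 : 1 ≤ x) (h1 : x < n) : ¬ (n:ℤ) ∣ x := by
  intro h; have := Int.le_of_dvd (by omega) h; omega

lemma sx_sq : sx * sx = 1 := by
  ext i j; fin_cases i <;> fin_cases j <;> simp [sx]
lemma sz_sq : sz * sz = 1 := by
  ext i j; fin_cases i <;> fin_cases j <;> simp [sz]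
lemma sxz : sx * sz = - (sz * sx) := by
  ext i j; fin_cases i <;> fin_cases j <;> simp [sz, sx]
lemma sxz' : sx * sz = Complex.I • sy := by
  ext i j; fin_cases i <;> fin_cases j <;> simp [sz, sx, sy]
lemma szx' : sz * sx = (-Complex.I) • sy := by
  ext i j; fin_cases i <;> fin_cases j <;> simp [sz, sx, sy]
lemma szxz : sz * sx * sz = (-1 : ℂ) • sx := by
  ext i j; fin_cases i <;> fin_cases j <;> simp [sz, sx]

/-- the chain of generators -/
def ee (n : ℕ) (i : ℤ) : M n := if i % 2 = 0 then op n sx (i / 2) else op n sz (i / 2) * op n sz (i / 2 + 1)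

lemma ee_even (j : ℤ) : ee n (2 * j) = op n sx j := by
  rw [ee, if_pos (by omega), show 2 * j / 2 = j by omega]
lemma ee_odd (j : ℤ) : ee n (2 * j + 1) = op n sz j * op n sz (j + 1) := by
  rw [ee, if_neg (by omega), show (2 * j + 1) / 2 = j by omega]

lemma par_cases (i : ℤ) : (∃ j, i = 2 * j) ∨ ∃ j, i = 2 * j + 1 := by
  rcases Int.emod_two_eq_zero_or_one i with h | h
  · exact Or.inl ⟨i / 2, by omega⟩
  · exact Or.inr ⟨i / 2, by omega⟩

lemma chain (hn : 3 ≤ n) : Chain n (ee n) where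
  per := by
    intro i
    rcases par_cases i with ⟨j, rfl⟩ | ⟨j, rfl⟩
    · rw [show 2 * j + 2 * (n:ℤ) = 2 * (j + n) by ring, ee_even, ee_even, op_per]
    · rw [show 2 * j + 1 + 2 * (n:ℤ) = 2 * (j + n) + 1 by ring, ee_odd, ee_odd, op_per,
        show j + n + 1 = j + 1 + n by ring, op_per]
  sq := by
    intro i
    rcases par_cases i with ⟨j, rfl⟩ | ⟨j, rfl⟩
    · rw [ee_even, op_mul, sx_sq, op_one]
    · rw [ee_odd, (op_comm sz sz (j + 1) j (Or.inl (Commute.refl _))).mul_mul_mul_comm, op_mul, op_mul, sz_sq,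
        op_one, op_one, mul_one]
  anti := by
    intro i
    rcases par_cases i with ⟨j, rfl⟩ | ⟨j, rfl⟩
    · rw [ee_even, ee_odd, ← mul_assoc, op_mul, sxz, op_neg (by omega), ← op_mul, neg_mul, mul_assoc, mul_assoc,
        (op_comm sx sz j (j + 1) (Or.inr (by rw [add_sub_cancel_left]; exact ndvd' (by omega) (by omega)))).eq]
    · rw [show 2 * j + 1 + 1 = 2 * (j + 1) by ring, ee_even, ee_odd, ← mul_assoc,
        ← (op_comm sz sx j (j + 1) (Or.inr (by rw [add_sub_cancel_left]; exact ndvd' (by omega) (by omega)))).eq,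
        mul_assoc, mul_assoc, op_mul, op_mul, sxz, op_neg (by omega), mul_neg, neg_neg]
  comm := by
    intro i k h1 h2
    have ezz : ∀ i j, Commute (op n sz i) (op n sz j) := fun i j => op_comm sz sz i j (Or.inl (Commute.refl _))
    have exz : ∀ i m : ℤ, 1 ≤ m → m < n → Commute (op n sx i) (op n sz (i + m)) := fun i m h1 h2 =>
      op_comm sx sz i _ (Or.inr (by rw [add_sub_cancel_left]; exact ndvd' h1 h2))
    have ezx : ∀ i m : ℤ, 1 ≤ m → m < n → Commute (op n sz i) (op n sx (i + m)) := fun i m h1 h2 =>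
      op_comm sz sx i _ (Or.inr (by rw [add_sub_cancel_left]; exact ndvd' h1 h2))
    rcases par_cases i with ⟨j, rfl⟩ | ⟨j, rfl⟩ <;> rcases par_cases k with ⟨l, rfl⟩ | ⟨l, rfl⟩
    · rw [← mul_add, ee_even, ee_even]
      exact (op_comm sx sx j (j + l) (Or.inl (Commute.refl _))).eq
    · rw [← add_assoc, ← mul_add, ee_even, ee_odd]
      refine ((exz j l (by omega) (by omega)).mul_right ?_).eq
      rw [add_assoc]; exact exz j (l + 1) (by omega) (by omega)
    · rw [show 2 * j + 1 + 2 * l = 2 * (j + l) + 1 by ring, ee_odd, ee_odd]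
      exact (((ezz _ _).mul_right (ezz _ _)).mul_left ((ezz _ _).mul_right (ezz _ _))).eq
    · rw [show 2 * j + 1 + (2 * l + 1) = 2 * (j + l + 1) by ring, ee_odd, ee_even]
      refine (Commute.mul_left ?_ ?_).eq
      · rw [add_assoc]; exact ezx j (l + 1) (by omega) (by omega)
      · rw [add_right_comm]; exact ezx (j + 1) l (by omega) (by omega)

lemma rot_val (hn : 2 ≤ n) (i : Fin n) : ((finRotate n i : ℕ) : ℤ) = (((i:ℕ):ℤ) + 1) % n := by
  obtain ⟨m, rfl⟩ : ∃ m, n = m + 2 := ⟨n - 2, by omega⟩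
  rw [finRotate_succ_apply, Fin.val_add]
  simp

lemma P_kron (f : Fin n → Matrix (Fin 2) (Fin 2) ℂ) : P n * kron f = kron (fun i => f (finRotate n i)) * P n := by
  ext x y
  simp only [Matrix.mul_apply, P]
  rw [Finset.sum_eq_single (fun i => x ((finRotate n).symm i)), Finset.sum_eq_single (fun i => y (finRotate n i))]
  · simp only [Equiv.symm_apply_apply, if_true, one_mul, mul_one, kron]
    rw [← Equiv.prod_comp (finRotate n)]; simp only [Equiv.symm_apply_apply]
  · intro b _ hb; rw [if_neg hb, mul_zero]
  · intro h; exact absurd (Finset.mem_univ _) h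
  · intro b _ hb
    rw [if_neg, zero_mul]
    rintro rfl
    apply hb; funext i; simp only [Equiv.apply_symm_apply]
  · intro h; exact absurd (Finset.mem_univ _) h

lemma P_unit : IsUnit (P n).det := by
  have : P n * (P n)ᵀ = 1 := by
    ext x y
    simp only [Matrix.mul_apply, Matrix.transpose_apply, P, Matrix.one_apply]
    rw [Finset.sum_eq_single (fun i => x ((finRotate n).symm i))]
    · simp only [Equiv.symm_apply_apply, if_true, one_mul]
      simp only [eq_comm]
    · intro b _ hb
      rw [if_neg, zero_mul]
      rintro rfl
      apply hb; funext i; simp only [Equiv.apply_symm_apply]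
    · intro h; exact absurd (Finset.mem_univ _) h
  have h2 := congrArg Matrix.det this
  rw [Matrix.det_mul, Matrix.det_one] at h2
  exact IsUnit.of_mul_eq_one _ h2

lemma P_kr (hn : 2 ≤ n) (j : ℤ) (F : ℤ → Matrix (Fin 2) (Fin 2) ℂ) : P n * kr n j F = kr n (j - 1) F * P n := by
  rw [kr, kr, P_kron]
  congr 2; funext i
  rw [rot_val hn, Int.emod_sub_emod]; congr 2; ring

lemma Pk_kr (hn : 2 ≤ n) (k : ℕ) (j : ℤ) (F : ℤ → Matrix (Fin 2) (Fin 2) ℂ) :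
    P n ^ k * kr n j F = kr n (j - k) F * P n ^ k := by
  induction k with
  | zero => simp
  | succ k ih =>
    rw [pow_succ', mul_assoc, ih, ← mul_assoc, P_kr hn, mul_assoc]; congr 2; push_cast; ring

lemma symmC_kr (hn : 2 ≤ n) (F : ℤ → Matrix (Fin 2) (Fin 2) ℂ) :
    symmC (kr n 0 F) = ∑ j ∈ Finset.range n, kr n j F := by
  rw [← sum_neg' n (fun j => kr n j F) (fun j => kr_per j F)]
  unfold symmC
  refine Finset.sum_congr rfl fun k _ => ?_
  rw [Pk_kr hn, mul_assoc, Matrix.mul_nonsing_inv, mul_one, zero_sub]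
  rw [Matrix.det_pow]; exact P_unit.pow k

lemma kr_zero (F : ℤ → Matrix (Fin 2) (Fin 2) ℂ) : kr n 0 F = kron fun i : Fin n => F ((i:ℕ):ℤ) := by
  unfold kr; congr 1; funext i
  rw [sub_zero, Int.emod_eq_of_lt (by omega) (by omega)]

lemma pauliAt_eq (σ : Matrix (Fin 2) (Fin 2) ℂ) (j : Fin n) (k : ℤ) (h : ((j:ℕ):ℤ) = k % n) :
    pauliAt n σ j = op n σ k := by
  unfold pauliAt op kr
  congr 1; funext i
  congr 1
  rw [← Int.emod_eq_emod_iff_emod_sub_eq_zero, ← h, Int.emod_eq_of_lt (by omega) (by omega)]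
  rw [Fin.ext_iff]; simp

lemma H1_eq : H1 n = Wd n (ee n) 0 1 := by
  rw [H1, Wd, Finset.sum_range]
  refine Finset.sum_congr rfl fun j _ => ?_
  rw [wd, wd, one_mul, Nat.cast_zero, add_zero, add_zero, ee_even]
  exact pauliAt_eq _ _ _ (by rw [Int.emod_eq_of_lt (by omega) (by omega)])

lemma H0_eq (hn : 2 ≤ n) : H0 n = Wd n (ee n) 1 1 := by
  rw [H0, Wd, Finset.sum_range]
  refine Finset.sum_congr rfl fun j _ => ?_
  rw [wd, wd, one_mul, Nat.cast_zero, add_zero, ee_odd]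
  rw [pauliAt_eq sz j j (by rw [Int.emod_eq_of_lt (by omega) (by omega)]), pauliAt_eq sz _ (j + 1) (rot_val hn j)]

lemma DLA_eq (hn : 2 ≤ n) : DLA n = Ons.DD (oA n (ee n)) := by
  rw [DLA, Ons.DD, oA_one, oA_zero, H1_eq, H0_eq hn, neg_smul, neg_neg]
end concrete


section strings
variable {n : ℕ}

/-- letters of a Pauli string -/
def SS (a b : Matrix (Fin 2) (Fin 2) ℂ) (m : ℕ) (t : ℤ) : Matrix (Fin 2) (Fin 2) ℂ :=
  if t = 0 then a else if t = m + 1 then b else if t ≤ m then sx else 1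

lemma str_eq (a b : Matrix (Fin 2) (Fin 2) ℂ) (m : ℕ) : str n a b m = kr n 0 (SS a b m) := by
  rw [kr_zero, str]
  congr 1; funext i
  unfold SS
  have e1 : ((i:ℕ) = 0) = (((i:ℕ):ℤ) = 0) := by simp
  have e2 : ((i:ℕ) = m + 1) = (((i:ℕ):ℤ) = (m:ℤ) + 1) := by apply propext; omega
  have e3 : ((i:ℕ) ≤ m) = (((i:ℕ):ℤ) ≤ (m:ℤ)) := by simp
  simp only [e1, e2, e3]

lemma symm_str (hn : 2 ≤ n) (a b : Matrix (Fin 2) (Fin 2) ℂ) (m : ℕ) :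
    symmC (str n a b m) = ∑ j ∈ Finset.range n, kr n j (SS a b m) := by
  rw [str_eq, symmC_kr hn]

lemma wzz (m : ℕ) (hm : m + 1 < n) (j : ℤ) :
    wd (ee n) (2 * j + 1) (2 * m + 1) = ((-1 : ℂ) ^ m) • kr n j (SS sz sz m) := by
  induction m with
  | zero =>
    rw [Nat.mul_zero, Nat.zero_add, wd, wd, one_mul, Nat.cast_zero, add_zero, ee_odd, pow_zero, one_smul]
    conv_lhs => rw [op]
    rw [kr_mul_op j 1 (by omega) (by omega)]
    refine kr_congr j fun t h0 h1 => ?_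
    simp only [SS]
    by_cases ht : t = 0
    · subst ht; simp
    · by_cases ht1 : t = 1
      · subst ht1; simp
      · simp only [ht, ht1, if_false]; rw [if_neg (by simpa using ht1), if_neg (by push_cast; omega)]
  | succ m ih =>
    have e1 : 2 * (m + 1) + 1 = 2 * m + 1 + 1 + 1 := by ring
    rw [e1, wd, wd, ih (by omega)]
    rw [show 2 * j + 1 + ((2 * m + 1 : ℕ) : ℤ) = 2 * (j + (m + 1)) by push_cast; ring,
      show 2 * j + 1 + ((2 * m + 1 + 1 : ℕ) : ℤ) = 2 * (j + (m + 1)) + 1 by push_cast; ring, ee_even, ee_odd,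
      smul_mul_assoc, smul_mul_assoc, ← mul_assoc, add_assoc j, kr_mul_op _ _ (by omega) (by omega),
      kr_mul_op _ _ (by omega) (by omega), kr_mul_op _ _ (by omega) (by omega), pow_succ, mul_smul]
    congr 1
    refine kr_smul j (-1) (m + 1) (by omega) (by omega) ?_ ?_
    · simp only [SS]
      rw [if_neg (by omega), if_pos trivial, if_pos trivial, if_neg (by omega), if_pos trivial, if_neg (by omega),
        if_neg (by push_cast; omega), if_pos (by push_cast; omega), szxz]
    · intro t h0 h1 h2
      simp only [SS, h2, if_false]
      by_cases ht : t = 0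
      · subst ht
        rw [if_neg (by omega), if_pos rfl, if_pos rfl]
      · by_cases ht1 : t = m + 1 + 1
        · subst ht1
          rw [if_pos rfl, if_neg (by omega), if_neg (by omega), if_neg (by omega), if_pos (by push_cast; omega), one_mul]
        · have ea : (t = ((m + 1 : ℕ) : ℤ) + 1) = False := by apply eq_false; push_cast; omega
          have eb : (t ≤ ((m + 1 : ℕ) : ℤ)) = (t ≤ (m : ℤ)) := by apply propext; push_cast; omega
          simp only [ea, eb, ht, ht1, if_false]

lemma wzy (m : ℕ) (hm : m + 1 < n) (j : ℤ) :
    wd (ee n) (2 * j + 1) (2 * m + 1 + 1) = ((-1 : ℂ) ^ m * (-Complex.I)) • kr n j (SS sz sy m) := by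
  rw [wd, wzz m hm, show 2 * j + 1 + ((2 * m + 1 : ℕ) : ℤ) = 2 * (j + (m + 1)) by push_cast; ring, ee_even,
    smul_mul_assoc, kr_mul_op _ _ (by omega) (by omega), mul_smul]
  congr 1
  refine kr_smul j _ (m + 1) (by omega) (by omega) ?_ ?_
  · simp only [SS]
    rw [if_pos trivial, if_neg (by omega), if_pos trivial, if_neg (by omega), if_pos trivial, szx']
  · intro t h0 h1 h2
    simp only [SS, h2, if_false]

lemma wyz (m : ℕ) (hm : m + 1 < n) (j : ℤ) :
    wd (ee n) (2 * j) (2 * m + 1 + 1) = ((-1 : ℂ) ^ m * Complex.I) • kr n j (SS sy sz m) := by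
  have e := op_mul_kr (n := n) j 0 le_rfl (by omega) (SS sz sz m) sx
  rw [add_zero] at e
  rw [wd_left, wzz m hm, ee_even, mul_smul_comm, e, mul_smul]
  congr 1
  refine kr_smul j _ 0 (by omega) (by omega) ?_ ?_
  · simp only [SS]
    rw [if_pos trivial, if_pos trivial, if_pos trivial, sxz']
  · intro t h0 h1 h2
    simp only [SS, h2, if_false]

lemma wyy (m : ℕ) (hm : m + 1 < n) (j : ℤ) :
    wd (ee n) (2 * j) (2 * m + 1 + 2) = ((-1 : ℂ) ^ m) • kr n j (SS sy sy m) := by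
  have e := op_mul_kr (n := n) j 0 le_rfl (by omega) (SS sz sy m) sx
  rw [add_zero] at e
  rw [wd_left, wzy m hm, ee_even, mul_smul_comm, e, mul_smul]
  congr 1
  rw [kr_smul j (F' := SS sy sy m) Complex.I 0 (by omega) (by omega), smul_smul]
  · simp
  · simp only [SS]
    rw [if_pos trivial, if_pos trivial, if_pos trivial, sxz']
  · intro t h0 h1 h2
    simp only [SS, h2, if_false]

lemma wxx (m : ℕ) (hm : n = m + 2) (j : ℤ) :
    wd (ee n) (2 * j + 1) (2 * (m + 1) + 1) =
      ((-1 : ℂ) ^ (m + 1)) • kr n (j + 1) (fun t => if t = m + 1 then 1 else sx) := by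
  have e1 : 2 * (m + 1) + 1 = 2 * m + 1 + 1 + 1 := by ring
  have e2 : op n sz (j + (m + 1) + 1) = op n sz (j + 0) := by
    rw [add_zero, ← op_per sz j]; congr 1; rw [hm]; push_cast; ring
  rw [e1, wd, wd, wzz m (by omega)]
  rw [show 2 * j + 1 + ((2 * m + 1 : ℕ) : ℤ) = 2 * (j + (m + 1)) by push_cast; ring,
    show 2 * j + 1 + ((2 * m + 1 + 1 : ℕ) : ℤ) = 2 * (j + (m + 1)) + 1 by push_cast; ring, ee_even, ee_odd, e2,
    smul_mul_assoc, smul_mul_assoc, ← mul_assoc, kr_mul_op _ _ (by omega) (by omega),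
    kr_mul_op _ _ (by omega) (by omega), kr_mul_op _ _ (by omega) (by omega), pow_succ, mul_smul]
  congr 1
  have e3 : kr n (j + 1) (fun t => if t = m + 1 then (1 : Matrix (Fin 2) (Fin 2) ℂ) else sx) =
      kr n j (fun t => if t = 0 then 1 else sx) := by
    unfold kr; congr 1; funext i
    have h1 := fin_emod i j
    have h2 := fin_emod i (j + 1)
    refine if_congr ?_ rfl rfl
    rw [← off_iff (((i:ℕ):ℤ) - (j + 1)) (m + 1) (by omega) (by omega)]
    rw [show ((i:ℕ):ℤ) - (j + 1) - (m + 1) = ((i:ℕ):ℤ) - j - n by omega, Int.sub_emod_right]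
  rw [e3]
  refine kr_smul j (-1) (m + 1) (by omega) (by omega) ?_ ?_
  · simp only [SS]
    rw [if_neg (by omega), if_pos trivial, if_pos trivial, if_neg (by omega), if_pos trivial, if_neg (by omega), szxz]
  · intro t h0 h1 h2
    simp only [SS, h2, if_false]
    by_cases ht : t = 0
    · subst ht
      rw [if_pos rfl, if_pos rfl, if_pos rfl, sz_sq]
    · rw [if_neg ht, if_neg ht, if_neg ht, if_pos (by omega)]

lemma sgn_sq (m : ℕ) : ((-1 : ℂ) ^ m) * (-1) ^ m = 1 := by
  rw [← mul_pow]; simp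

lemma Z_eq (m : ℕ) (hm : m + 1 < n) : oA n (ee n) (m + 1) = Z n m := by
  rw [oA_pos, Wd, Z, symm_str (by omega), Finset.smul_sum, Finset.smul_sum]
  refine Finset.sum_congr rfl fun j _ => ?_
  rw [wzz m hm, smul_smul, mul_right_comm, sgn_sq, one_mul]

lemma Y_eq (m : ℕ) (hm : m + 1 < n) : oA n (ee n) (-(m + 1)) = Y n m := by
  rw [oA_neg1, Wd, Y, symm_str (by omega), Finset.smul_sum, Finset.smul_sum]
  refine Finset.sum_congr rfl fun j _ => ?_
  rw [add_zero, wyy m hm, smul_smul, mul_right_comm, sgn_sq, one_mul]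

lemma X_eq (hn : 2 ≤ n) : oA n (ee n) 0 = - X n := by
  have e : (kron fun i : Fin n => if (i : ℕ) = 0 then sx else 1) = kr n 0 (fun t => if t = 0 then sx else 1) := by
    rw [kr_zero]; simp only [Nat.cast_eq_zero]
  rw [oA_zero, Wd, X, e, symmC_kr hn, neg_smul]
  congr 2
  refine Finset.sum_congr rfl fun j _ => ?_
  rw [wd, wd, one_mul, Nat.cast_zero, add_zero, add_zero, ee_even, op]

lemma XX_eq (hn : 2 ≤ n) : oA n (ee n) n = XX n := by
  obtain ⟨m, hm⟩ : ∃ m, n = m + 2 := ⟨n - 2, by omega⟩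
  have e : (kron fun i : Fin n => if (i : ℕ) = n - 1 then 1 else sx) = kr n 0 (fun t => if t = m + 1 then 1 else sx) := by
    rw [kr_zero]
    have : ∀ i : Fin n, ((i:ℕ) = n - 1) = (((i:ℕ):ℤ) = m + 1) := fun i => by apply propext; omega
    simp only [this]
  have := oA_pos (n := n) (e := ee n) (m + 1)
  rw [show (((m + 1 : ℕ) : ℤ) + 1) = (n : ℤ) by rw [hm]; push_cast; ring] at this
  rw [this, Wd, XX, e, symmC_kr hn,
    ← sum_shift n (fun j : ℤ => kr n j (fun t => if t = m + 1 then 1 else sx)) (fun j => kr_per j _) 1,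
    Finset.smul_sum, Finset.smul_sum]
  refine Finset.sum_congr rfl fun j _ => ?_
  rw [wxx m hm, smul_smul, mul_right_comm, sgn_sq, one_mul]

lemma YZ_eq (m : ℕ) (hm : m + 1 < n) : oG n (ee n) (m + 1) = YZ n m := by
  have := oG_nat (n := n) (e := ee n) (m + 1)
  push_cast at this
  rw [this, gN_succ, Wd, Wd, YZ, symm_str (by omega), symm_str (by omega)]
  simp only [Finset.smul_sum]
  rw [← Finset.sum_sub_distrib, ← Finset.sum_add_distrib]
  refine Finset.sum_congr rfl fun j _ => ?_
  rw [add_zero, wyz m hm, wzy m hm]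
  have s := sgn_sq m
  simp only [smul_smul]
  rw [show (-1 : ℂ) ^ m * ((-1) ^ m * Complex.I) = Complex.I by linear_combination Complex.I * s,
    show (-1 : ℂ) ^ m * ((-1) ^ m * -Complex.I) = -Complex.I by linear_combination -Complex.I * s]
  module
end strings


section entries
variable {n : ℕ}

lemma kr_apply (j : ℤ) (F : ℤ → Matrix (Fin 2) (Fin 2) ℂ) (x y : Fin n → Fin 2) :
    kr n j F x y = ∏ i : Fin n, F ((((i : ℕ) : ℤ) - j) % n) (x i) (y i) := rfl

lemma kr0_apply (F : ℤ → Matrix (Fin 2) (Fin 2) ℂ) (x y : Fin n → Fin 2) :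
    kr n 0 F x y = ∏ i : Fin n, F ((i : ℕ) : ℤ) (x i) (y i) := by rw [kr_zero]; rfl

lemma kr_z (i : Fin n) {j : ℤ} {F : ℤ → Matrix (Fin 2) (Fin 2) ℂ} {x y : Fin n → Fin 2}
    (h : F ((((i : ℕ) : ℤ) - j) % n) (x i) (y i) = 0) : kr n j F x y = 0 :=
  Finset.prod_eq_zero (Finset.mem_univ i) h

lemma flip1 {F : ℤ → Matrix (Fin 2) (Fin 2) ℂ} (t : ℤ) (h0 : 0 ≤ t) (h1 : t < n) (hF : ∀ a, F t a a = 0)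
    (j : ℤ) (x : Fin n → Fin 2) : kr n j F x x = 0 := by
  obtain ⟨i, hi⟩ := exists_site j t h0 h1
  exact kr_z i (by rw [hi, hF])

lemma flip2 {F : ℤ → Matrix (Fin 2) (Fin 2) ℂ} (t t' : ℤ) (h0 : 0 ≤ t) (h1 : t < n) (hF : ∀ a, F t a a = 0)
    (h0' : 0 ≤ t') (h1' : t' < n) (hF' : ∀ a, F t' a a = 0) (htt : t ≠ t')
    (j : ℤ) (x y : Fin n → Fin 2) (hxy : ∀ i : Fin n, (i : ℕ) ≠ 0 → x i = y i) : kr n j F x y = 0 := by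
  obtain ⟨i, hi⟩ := exists_site j t h0 h1
  obtain ⟨i', hi'⟩ := exists_site j t' h0' h1'
  by_cases h : (i : ℕ) = 0
  · have h' : (i' : ℕ) ≠ 0 := by
      intro h'
      apply htt; rw [← hi, ← hi', h, h']
    exact kr_z i' (by rw [hi', hxy i' h', hF'])
  · exact kr_z i (by rw [hi, hxy i h, hF])

lemma sum_one {F : ℤ → Matrix (Fin 2) (Fin 2) ℂ} (t : ℤ) (h0 : 0 ≤ t) (h1 : t < n) (hF : ∀ a, F t a a = 0)
    (x y : Fin n → Fin 2) (hxy : ∀ i : Fin n, (i : ℕ) ≠ 0 → x i = y i) :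
    ∑ j ∈ Finset.range n, kr n j F x y = kr n (0 - t) F x y := by
  rw [← sum_shift n (fun j : ℤ => kr n j F x y) (fun j => by simp only [kr_per]) (-t)]
  rw [Finset.sum_eq_single 0]
  · rw [Nat.cast_zero, sub_eq_add_neg]
  · intro j hj hj0
    refine kr_z ⟨j, Finset.mem_range.mp hj⟩ ?_
    have : ((j:ℤ) - (j + -t)) % n = t := by
      rw [show (j:ℤ) - (j + -t) = t by ring, Int.emod_eq_of_lt h0 h1]
    simp only [this]
    rw [hxy _ hj0, hF]
  · intro h; exfalso; apply h; rw [Finset.mem_range]; omega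

lemma sx_d (a : Fin 2) : sx a a = 0 := by fin_cases a <;> simp [sx]
lemma sy_d (a : Fin 2) : sy a a = 0 := by fin_cases a <;> simp [sy]

lemma SS_zero (a b : Matrix (Fin 2) (Fin 2) ℂ) (m : ℕ) : SS a b m 0 = a := if_pos rfl
lemma SS_last (a b : Matrix (Fin 2) (Fin 2) ℂ) (m : ℕ) : SS a b m (m + 1) = b := by
  rw [SS, if_neg (by omega), if_pos rfl]
lemma SS_mid (a b : Matrix (Fin 2) (Fin 2) ℂ) (m : ℕ) (t : ℤ) (h0 : 1 ≤ t) (h1 : t ≤ m) : SS a b m t = sx := by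
  rw [SS, if_neg (by omega), if_neg (by omega), if_pos h1]
lemma SS_out (a b : Matrix (Fin 2) (Fin 2) ℂ) (m : ℕ) (t : ℤ) (h1 : m + 1 < t) : SS a b m t = 1 := by
  rw [SS, if_neg (by omega), if_neg (by omega), if_neg (by omega)]

lemma sm_apply (f : ℕ → M n) (x y : Fin n → Fin 2) :
    (Complex.I • ∑ j ∈ Finset.range n, f j) x y = Complex.I * ∑ j ∈ Finset.range n, f j x y := by
  rw [Matrix.smul_apply, Matrix.sum_apply, smul_eq_mul]

lemma sm_zero (f : ℕ → M n) (x y : Fin n → Fin 2) (h : ∀ j, f j x y = 0) :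
    (Complex.I • ∑ j ∈ Finset.range n, f j) x y = 0 := by
  rw [sm_apply, Finset.sum_eq_zero fun j _ => h j, mul_zero]

lemma XX_str (hn : 2 ≤ n) : XX n = Complex.I • ∑ j ∈ Finset.range n, kr n j (fun t => if t = n - 1 then 1 else sx) := by
  have e : (kron fun i : Fin n => if (i : ℕ) = n - 1 then 1 else sx) =
      kr n 0 (fun t => if t = n - 1 then 1 else sx) := by
    rw [kr_zero]
    have : ∀ i : Fin n, ((i:ℕ) = n - 1) = (((i:ℕ):ℤ) = n - 1) := fun i => by apply propext; omega
    simp only [this]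
  rw [XX, e, symmC_kr hn]

lemma X_str (hn : 2 ≤ n) : X n = Complex.I • ∑ j ∈ Finset.range n, kr n j (fun t => if t = 0 then sx else 1) := by
  have e : (kron fun i : Fin n => if (i : ℕ) = 0 then sx else 1) = kr n 0 (fun t => if t = 0 then sx else 1) := by
    rw [kr_zero]; simp only [Nat.cast_eq_zero]
  rw [X, e, symmC_kr hn]

lemma Z_str (hn : 2 ≤ n) (m : ℕ) : Z n m = Complex.I • ∑ j ∈ Finset.range n, kr n j (SS sz sz m) := by
  rw [Z, symm_str hn]
lemma Y_str (hn : 2 ≤ n) (m : ℕ) : Y n m = Complex.I • ∑ j ∈ Finset.range n, kr n j (SS sy sy m) := by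
  rw [Y, symm_str hn]

/-- test vectors -/
def x0 (n : ℕ) : Fin n → Fin 2 := fun _ => 0
def y0 (n : ℕ) : Fin n → Fin 2 := fun i => if (i:ℕ) = 0 then 1 else 0
def v0 (n : ℕ) : Fin n → Fin 2 := fun i => if (i:ℕ) = 1 then 1 else 0
def v1 (n : ℕ) : Fin n → Fin 2 := fun i => if (i:ℕ) ≤ 1 then 1 else 0

lemma xy0 (i : Fin n) (h : (i:ℕ) ≠ 0) : x0 n i = y0 n i := by simp [x0, y0, h]
lemma v01 (i : Fin n) (h : (i:ℕ) ≠ 0) : v0 n i = v1 n i := by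
  have : ((i:ℕ) ≤ 1) = ((i:ℕ) = 1) := by apply propext; omega
  simp only [v0, v1, this]

lemma X_d (hn : 3 ≤ n) : X n (x0 n) (x0 n) = 0 := by
  rw [X_str (by omega)]
  exact sm_zero _ _ _ fun j => flip1 0 (by omega) (by omega) (by simp [sx_d]) _ _
lemma XX_d (hn : 3 ≤ n) : XX n (x0 n) (x0 n) = 0 := by
  rw [XX_str (by omega)]
  refine sm_zero _ _ _ fun j => flip1 0 (by omega) (by omega) ?_ _ _
  rw [if_neg (by omega)]; exact sx_d
lemma Y_d (hn : 3 ≤ n) (m : ℕ) : Y n m (x0 n) (x0 n) = 0 := by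
  rw [Y_str (by omega)]
  exact sm_zero _ _ _ fun j => flip1 0 (by omega) (by omega) (by rw [SS_zero]; exact sy_d) _ _
lemma Z_d (hn : 3 ≤ n) (m : ℕ) (hm : 1 ≤ m) : Z n m (x0 n) (x0 n) = 0 := by
  rw [Z_str (by omega)]
  exact sm_zero _ _ _ fun j => flip1 1 (by omega) (by omega)
    (by rw [SS_mid _ _ _ _ (by omega) (by omega)]; exact sx_d) _ _

lemma SSz (t : ℤ) (h : 0 ≤ t) : SS sz sz 0 t = sz ∨ SS sz sz 0 t = 1 := by
  rcases lt_trichotomy t 1 with h1 | h1 | h1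
  · left; rw [show t = 0 by omega, SS_zero]
  · left; rw [h1]; exact SS_last sz sz 0
  · right; exact SS_out sz sz 0 t (by simpa using h1)

lemma Z0_d (hn : 3 ≤ n) : Z n 0 (x0 n) (x0 n) = Complex.I * n := by
  rw [Z_str (by omega), sm_apply]
  congr 1
  rw [Finset.sum_congr rfl (g := fun _ => (1:ℂ))]
  · simp
  · intro j _
    rw [kr_apply]
    refine Finset.prod_eq_one fun i _ => ?_
    rcases SSz _ (fin_emod i j).1 with h | h <;> rw [h] <;> simp [x0, sz]

lemma X_f (hn : 3 ≤ n) : X n (v0 n) (v1 n) = Complex.I := by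
  rw [X_str (by omega), sm_apply, sum_one 0 (by omega) (by omega) (by simp [sx_d]) _ _ v01]
  have : kr n (0 - 0) (fun t => if t = 0 then sx else 1) (v0 n) (v1 n) = 1 := by
    rw [sub_zero, kr0_apply]
    refine Finset.prod_eq_one fun i _ => ?_
    by_cases h : (i:ℕ) = 0
    · simp [h, sx, v0, v1]
    · rw [← v01 i h]; simp [h]
  rw [this, mul_one]

lemma XX_f (hn : 3 ≤ n) : XX n (v0 n) (v1 n) = 0 := by
  rw [XX_str (by omega)]
  refine sm_zero _ _ _ fun j => flip2 0 1 (by omega) (by omega) ?_ (by omega) (by omega) ?_ (by omega) _ _ _ v01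
  · rw [if_neg (by omega)]; exact sx_d
  · rw [if_neg (by omega)]; exact sx_d
lemma Y_f (hn : 3 ≤ n) (m : ℕ) (hm : m + 1 < n) : Y n m (v0 n) (v1 n) = 0 := by
  rw [Y_str (by omega)]
  refine sm_zero _ _ _ fun j => flip2 0 (m + 1) (by omega) (by omega) ?_ (by omega) (by omega) ?_ (by omega) _ _ _ v01
  · rw [SS_zero]; exact sy_d
  · rw [SS_last]; exact sy_d
lemma Z_f (hn : 3 ≤ n) (m : ℕ) (hm : 2 ≤ m) : Z n m (v0 n) (v1 n) = 0 := by
  rw [Z_str (by omega)]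
  refine sm_zero _ _ _ fun j => flip2 1 2 (by omega) (by omega) ?_ (by omega) (by omega) ?_ (by omega) _ _ _ v01
  · rw [SS_mid _ _ _ _ (by omega) (by omega)]; exact sx_d
  · rw [SS_mid _ _ _ _ (by omega) (by omega)]; exact sx_d
lemma Z0_f (hn : 3 ≤ n) : Z n 0 (v0 n) (v1 n) = 0 := by
  rw [Z_str (by omega)]
  refine sm_zero _ _ _ fun j => kr_z ⟨0, by omega⟩ ?_
  rcases SSz _ (fin_emod (n := n) ⟨0, by omega⟩ j).1 with h | h <;> rw [h] <;> simp [v0, v1, sz]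

lemma Z1_f (hn : 3 ≤ n) : Z n 1 (v0 n) (v1 n) = -Complex.I := by
  rw [Z_str (by omega), sm_apply, sum_one 1 (by omega) (by omega)
    (by rw [SS_mid _ _ _ _ (by omega) (by omega)]; exact sx_d) _ _ v01]
  have : kr n (0 - 1) (SS sz sz 1) (v0 n) (v1 n) = -1 := by
    rw [kr_apply]
    rw [Finset.prod_eq_single (⟨1, by omega⟩ : Fin n)]
    · have : (((1:ℕ):ℤ) - (0 - 1)) % n = ((1:ℕ):ℤ) + 1 := by
        rw [Int.emod_eq_of_lt (by omega) (by omega)]; norm_num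
      simp only [this, SS_last]
      simp [v0, v1, sz]
    · intro i _ hi
      have hi1 : (i:ℕ) ≠ 1 := fun h => hi (Fin.ext h)
      rcases Nat.lt_or_ge (i + 1) n with h | h
      · have e : (((i:ℕ):ℤ) - (0 - 1)) % n = (i:ℕ) + 1 := by
          rw [Int.emod_eq_of_lt (by omega) (by omega)]; ring
        rw [e]
        by_cases h0 : (i:ℕ) = 0
        · rw [SS_mid _ _ _ _ (by omega) (by omega)]
          simp [h0, v0, v1, sx]
        · rw [SS_out _ _ _ _ (by omega), ← v01 i h0]; simp
      · have e : (((i:ℕ):ℤ) - (0 - 1)) % n = 0 := by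
          have := i.2
          rw [show ((i:ℕ):ℤ) - (0 - 1) = n by omega, Int.emod_self]
        rw [e, SS_zero, ← v01 i (by omega)]
        simp [v0, hi1, sz]
    · intro h; exact absurd (Finset.mem_univ _) h
  rw [this]; ring

lemma YZ_apply (hn : 3 ≤ n) (m : ℕ) (x y : Fin n → Fin 2) : YZ n m x y =
    Complex.I * ∑ j ∈ Finset.range n, kr n j (SS sz sy m) x y +
    Complex.I * ∑ j ∈ Finset.range n, kr n j (SS sy sz m) x y := by
  rw [YZ, symm_str (by omega), symm_str (by omega), Matrix.add_apply, sm_apply, sm_apply]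

lemma YZ_z (hn : 3 ≤ n) (m : ℕ) (hm : m + 2 < n) : YZ n (m + 1) (x0 n) (y0 n) = 0 := by
  rw [YZ_apply hn, Finset.sum_eq_zero, Finset.sum_eq_zero, mul_zero, add_zero]
  · intro j _
    refine flip2 0 1 (by omega) (by omega) ?_ (by omega) (by omega) ?_ (by omega) _ _ _ xy0
    · rw [SS_zero]; exact sy_d
    · rw [SS_mid _ _ _ _ (by omega) (by omega)]; exact sx_d
  · intro j _
    refine flip2 ((m + 1 : ℕ) + 1) 1 (by omega) (by omega) ?_ (by omega) (by omega) ?_ (by omega) _ _ _ xy0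
    · rw [SS_last]; exact sy_d
    · rw [SS_mid _ _ _ _ (by omega) (by omega)]; exact sx_d

lemma YZ_0 (hn : 3 ≤ n) : YZ n 0 (x0 n) (y0 n) = -2 := by
  have e1 : kr n (0 - 1) (SS sz sy 0) (x0 n) (y0 n) = Complex.I := by
    rw [kr_apply]
    rw [Finset.prod_eq_single (⟨0, by omega⟩ : Fin n)]
    · have : (((0:ℕ):ℤ) - (0 - 1)) % n = ((0:ℕ):ℤ) + 1 := by
        rw [Int.emod_eq_of_lt (by omega) (by omega)]; norm_num
      simp only [this, SS_last]
      simp [x0, y0, sy]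
    · intro i _ hi
      have hi1 : (i:ℕ) ≠ 0 := fun h => hi (Fin.ext h)
      rw [← xy0 i hi1]
      rcases Nat.lt_or_ge (i + 1) n with h | h
      · have e : (((i:ℕ):ℤ) - (0 - 1)) % n = (i:ℕ) + 1 := by
          rw [Int.emod_eq_of_lt (by omega) (by omega)]; ring
        rw [e, SS_out _ _ _ _ (by omega)]; simp
      · have e : (((i:ℕ):ℤ) - (0 - 1)) % n = 0 := by
          have := i.2
          rw [show ((i:ℕ):ℤ) - (0 - 1) = n by omega, Int.emod_self]
        rw [e, SS_zero]
        simp [x0, sz]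
    · intro h; exact absurd (Finset.mem_univ _) h
  have e2 : kr n (0 - 0) (SS sy sz 0) (x0 n) (y0 n) = Complex.I := by
    rw [sub_zero, kr0_apply]
    rw [Finset.prod_eq_single (⟨0, by omega⟩ : Fin n)]
    · rw [Nat.cast_zero, SS_zero]
      simp [x0, y0, sy]
    · intro i _ hi
      have hi1 : (i:ℕ) ≠ 0 := fun h => hi (Fin.ext h)
      rw [← xy0 i hi1]
      by_cases h : (i:ℕ) = 1
      · have := SS_last sy sz 0
        rw [Nat.cast_zero, zero_add] at this
        rw [h, Nat.cast_one, this]; simp [x0, sz]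
      · rw [SS_out _ _ _ _ (by omega)]; simp
    · intro h; exact absurd (Finset.mem_univ _) h
  rw [YZ_apply hn, sum_one 1 (by omega) (by omega) (by
    have := SS_last sz sy 0
    rw [Nat.cast_zero, zero_add] at this
    rw [this]; exact sy_d) _ _ xy0, sum_one 0 (by omega) (by omega) (by rw [SS_zero]; exact sy_d) _ _ xy0, e1, e2,
    Complex.I_mul_I]
  norm_num

lemma Zhat_ne (hn : 3 ≤ n) (lam : ℝ) : Zhat n lam ≠ 0 := by
  intro h
  have h2 : (Zhat n lam) (x0 n) (y0 n) = 0 := by rw [h]; rfl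
  rw [Zhat, Matrix.sum_apply, Finset.sum_eq_single 0] at h2
  · rw [aSeq, one_smul, YZ_0 hn] at h2
    norm_num at h2
  · intro k hk h0
    obtain ⟨m, rfl⟩ : ∃ m, k = m + 1 := ⟨k - 1, by omega⟩
    rw [Finset.mem_range] at hk
    rw [Matrix.smul_apply, YZ_z hn m (by omega), smul_zero]
  · intro h; exfalso; apply h; rw [Finset.mem_range]; omega
end entries


section final
variable {n : ℕ}

lemma Z_eq' (k : ℤ) (m : ℕ) (hk : k = m + 1) (hm : m + 1 < n) : oA n (ee n) k = Z n m := by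
  rw [hk]; exact Z_eq m hm
lemma Y_eq' (k : ℤ) (m : ℕ) (hk : k = -(m + 1)) (hm : m + 1 < n) : oA n (ee n) k = Y n m := by
  rw [hk]; exact Y_eq m hm

lemma Zhat_eq (lam : ℝ) :
    Zhat n lam = ∑ k ∈ Finset.range (n - 1), aSeq lam k • oG n (ee n) (k + 1) := by
  rw [Zhat]
  refine Finset.sum_congr rfl fun k hk => ?_
  rw [Finset.mem_range] at hk
  rw [YZ_eq k (by omega)]

lemma Yhat_eq (lam : ℝ) :
    Yhat n lam = ∑ k ∈ Finset.range (n - 1), aSeq lam k • (oA n (ee n) (0 - (k + 1)) - oA n (ee n) (0 + (k + 1))) := by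
  rw [Yhat]
  refine Finset.sum_congr rfl fun k hk => ?_
  rw [Finset.mem_range] at hk
  rw [Y_eq' _ k (by ring) (by omega), Z_eq' _ k (by ring) (by omega)]

lemma Xhat_eq (hn : 3 ≤ n) (lam : ℝ) :
    Xhat n lam = ∑ k ∈ Finset.range (n - 1), aSeq lam k • (oA n (ee n) (1 + (k + 1)) - oA n (ee n) (1 - (k + 1))) := by
  obtain ⟨m, hm⟩ : ∃ m, n = m + 3 := ⟨n - 3, by omega⟩
  have e2 : n - 2 = m + 1 := by omega
  have e3 : n - 3 = m := by omega
  rw [Xhat, show n - 1 = m + 1 + 1 by omega, Finset.sum_range_succ, Finset.sum_range_succ', e2, e3]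
  have eI : Finset.Icc 1 m = Finset.Ico 1 (m + 1) := by ext; simp only [Finset.mem_Icc, Finset.mem_Ico]; omega
  rw [eI, Finset.sum_Ico_eq_sum_range, Nat.add_sub_cancel]
  have s : ∑ k ∈ Finset.range m, aSeq lam (1 + k) • (Z n (1 + k + 1) - Y n (1 + k - 1)) =
      ∑ k ∈ Finset.range m, aSeq lam (k + 1) •
        (oA n (ee n) (1 + ((k + 1 : ℕ) + 1)) - oA n (ee n) (1 - ((k + 1 : ℕ) + 1))) := by
    refine Finset.sum_congr rfl fun k hk => ?_
    rw [Finset.mem_range] at hk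
    rw [add_comm 1 k, Z_eq' _ (k + 1 + 1) (by push_cast; ring) (by omega), Nat.add_sub_cancel,
      Y_eq' _ k (by push_cast; ring) (by omega)]
  rw [s]
  have a1 : oA n (ee n) (1 + ((0 : ℕ) + 1)) = Z n 1 := Z_eq' _ 1 (by norm_num) (by omega)
  have a2 : oA n (ee n) (1 - ((0 : ℕ) + 1)) = - X n := by
    rw [show (1 - (((0 : ℕ):ℤ) + 1)) = 0 by norm_num, X_eq (by omega)]
  have a3 : oA n (ee n) (1 + ((m + 1 : ℕ) + 1)) = XX n := by
    rw [show (1 + (((m + 1 : ℕ):ℤ) + 1)) = n by omega, XX_eq (by omega)]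
  have a4 : oA n (ee n) (1 - ((m + 1 : ℕ) + 1)) = Y n m := Y_eq' _ m (by push_cast; ring) (by omega)
  rw [a1, a2, a3, a4, aSeq, one_smul]
  abel

lemma Ideal_eq (hn : 3 ≤ n) {j : ℕ} (hj : 1 ≤ j) (hj' : j < n) :
    Ideal n (rt n j) = Ons.JJ n (oA n (ee n)) (oG n (ee n)) j ∧ Ons.sS n (oG n (ee n)) j ≠ 0 := by
  have h := ons (chain hn) (by omega)
  obtain ⟨h1, h2⟩ := h.hats_span (by omega) hj hj' _ _ _ (Xhat_eq hn _) (Yhat_eq _) (Zhat_eq _)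
  refine ⟨h1, ?_⟩
  rw [h2]
  refine smul_ne_zero (mul_ne_zero two_ne_zero ?_) (Zhat_ne hn _)
  have hn0 : (0:ℝ) < n := by exact_mod_cast (by omega : 0 < n)
  have hj0 : (0:ℝ) < j := by exact_mod_cast (by omega : 0 < j)
  have hjn : (j:ℝ) < n := by exact_mod_cast hj'
  refine (Real.sin_pos_of_pos_of_lt_pi ?_ ?_).ne'
  · unfold Ons.th; push_cast; positivity
  · unfold Ons.th; push_cast
    rw [div_lt_iff₀ hn0, mul_comm]
    exact mul_lt_mul_of_pos_left hjn Real.pi_pos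

lemma half_sum' {V : Type*} [AddCommGroup V] (hn : 0 < n) (f : ℤ → V) (hf : ∀ k, f (k + (2 * n : ℕ)) = f k) :
    ∑ k ∈ Finset.range (2 * n), f k = f 0 + f n + ∑ k ∈ Finset.range (n - 1), (f (k + 1) + f (-(k + 1))) := by
  obtain ⟨m, rfl⟩ : ∃ m, n = m + 1 := ⟨n - 1, by omega⟩
  have hs : ∑ k ∈ Finset.range m, f ((m + 1 + (k + 1) : ℕ) : ℤ) = ∑ k ∈ Finset.range m, f (-((k:ℤ) + 1)) := by
    rw [← Finset.sum_range_reflect (fun k : ℕ => f (-((k:ℤ) + 1)))]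
    refine Finset.sum_congr rfl fun k hk => ?_
    rw [Finset.mem_range] at hk
    rw [← hf (-(((m - 1 - k : ℕ) : ℤ) + 1))]
    congr 1; omega
  rw [Nat.add_sub_cancel, Finset.sum_add_distrib, two_mul, Finset.sum_range_add, Finset.sum_range_succ',
    Finset.sum_range_succ', hs]
  push_cast
  rw [add_zero]
  abel

/-- an entry of a central element -/
lemma KK_entry (hn : 3 ≤ n) (a b : ℝ) (x y : Fin n → Fin 2)
    (h : a • Ons.cS n (oA n (ee n)) 0 + b • Ons.cS n (oA n (ee n)) n = 0) :
    ((a + b : ℝ) : ℂ) * (- X n x y) + ((a * Real.cos ((n:ℤ) * Ons.th n 0) + b * Real.cos ((n:ℤ) * Ons.th n n) : ℝ) : ℂ)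
      * XX n x y + ∑ k ∈ Finset.range (n - 1),
        (((a + b * (-1) ^ (k + 1) : ℝ) : ℂ) * Z n k x y + ((a + b * (-1) ^ (k + 1) : ℝ) : ℂ) * Y n k x y) = 0 := by
  have ho := ons (chain hn) (by omega)
  have hn' : (n:ℝ) ≠ 0 := by exact_mod_cast (by omega : n ≠ 0)
  have c0 : ∀ k : ℤ, Real.cos (k * Ons.th n 0) = 1 := by intro k; simp [Ons.th]
  have thn : Ons.th n n = Real.pi := by unfold Ons.th; push_cast; field_simp
  have c1 : ∀ k : ℕ, Real.cos ((((k:ℤ) + 1 : ℤ) : ℝ) * Real.pi) = (-1) ^ (k + 1) := by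
    intro k
    have := Real.cos_nat_mul_pi (k + 1)
    push_cast at this ⊢; exact this
  let f : ℤ → ℂ := fun k => ((a * Real.cos (k * Ons.th n 0) + b * Real.cos (k * Ons.th n n) : ℝ) : ℂ) *
    oA n (ee n) k x y
  have hf := half_sum' (n := n) (by omega) f (by
    intro k
    simp only [f]
    rw [Ons.cos_per (by omega), Ons.cos_per (by omega), ho.perA'])
  have h2 : ∑ k ∈ Finset.range (2 * n), f k = 0 := by
    have := congrFun (congrFun h x) y
    rw [Ons.cS, Ons.cS, Finset.smul_sum, Finset.smul_sum, ← Finset.sum_add_distrib, Matrix.sum_apply] at this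
    rw [Matrix.zero_apply] at this
    rw [← this]
    refine Finset.sum_congr rfl fun k _ => ?_
    simp only [f, Matrix.add_apply, Matrix.smul_apply, Complex.real_smul]
    push_cast; ring
  rw [h2] at hf
  rw [hf]
  congr 1
  · congr 1
    · simp only [f]
      rw [X_eq (by omega), c0, thn]
      simp
    · simp only [f]
      rw [XX_eq (by omega)]
  · refine Finset.sum_congr rfl fun k hk => ?_
    rw [Finset.mem_range] at hk
    simp only [f]
    rw [Z_eq k (by omega), Y_eq k (by omega), c0, c0, thn, c1, mul_one, Int.cast_neg, neg_mul, Real.cos_neg, c1]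

lemma KK_indep (hn : 3 ≤ n) (a b : ℝ)
    (h : a • Ons.cS n (oA n (ee n)) 0 + b • Ons.cS n (oA n (ee n)) n = 0) : a = 0 ∧ b = 0 := by
  have hn' : (n:ℂ) ≠ 0 := by exact_mod_cast (by omega : n ≠ 0)
  have h1 := KK_entry hn a b (x0 n) (x0 n) h
  have h2 := KK_entry hn a b (v0 n) (v1 n) h
  rw [X_d hn, XX_d hn, neg_zero, mul_zero, mul_zero, add_zero, zero_add, Finset.sum_eq_single 0] at h1
  · rw [X_f hn, XX_f hn, mul_zero, add_zero, Finset.sum_eq_single 1] at h2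
    · rw [Z0_d hn, Y_d hn, mul_zero, add_zero] at h1
      rw [Z1_f hn, Y_f hn 1 (by omega), mul_zero, add_zero] at h2
      have h3 : ((a + b * (-1) ^ (0 + 1) : ℝ) : ℂ) = 0 := by
        rcases mul_eq_zero.mp h1 with h | h
        · exact h
        · exact absurd h (mul_ne_zero Complex.I_ne_zero hn')
      have h4 : ((a + b : ℝ) : ℂ) = 0 := by
        have : ((a + b : ℝ) : ℂ) * (-2 * Complex.I) = 0 := by
          rw [← h2]; push_cast; ring
        rcases mul_eq_zero.mp this with h | h
        · exact h
        · exact absurd h (mul_ne_zero (by norm_num) Complex.I_ne_zero)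
      have h3' : a + b * (-1) ^ (0 + 1) = 0 := by exact_mod_cast h3
      have h4' : a + b = 0 := by exact_mod_cast h4
      rw [zero_add, pow_one] at h3'
      constructor <;> linarith
    · intro k hk h0
      rw [Finset.mem_range] at hk
      rw [Y_f hn k (by omega), mul_zero, add_zero]
      rcases Nat.eq_zero_or_pos k with rfl | hp
      · rw [Z0_f hn, mul_zero]
      · rw [Z_f hn k (by omega), mul_zero]
    · intro h; exfalso; apply h; rw [Finset.mem_range]; omega
  · intro k hk h0
    rw [Z_d hn k (by omega), Y_d hn, mul_zero, add_zero]
  · intro h; exfalso; apply h; rw [Finset.mem_range]; omega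

lemma KK_rank (hn : 3 ≤ n) : Module.finrank ℝ (Ons.KK n (oA n (ee n))) = 2 := by
  have hl : LinearIndependent ℝ ![Ons.cS n (oA n (ee n)) 0, Ons.cS n (oA n (ee n)) n] := by
    rw [LinearIndependent.pair_iff]
    exact fun a b h => KK_indep hn a b h
  have := finrank_span_eq_card hl
  have hr : Set.range ![Ons.cS n (oA n (ee n)) 0, Ons.cS n (oA n (ee n)) n] =
      {Ons.cS n (oA n (ee n)) 0, Ons.cS n (oA n (ee n)) n} := by
    rw [Matrix.range_cons, Matrix.range_cons, Matrix.range_empty, Set.union_empty]; rfl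
  rw [hr] at this
  simpa using this

theorem main (hn : 3 ≤ n) :
    {lam : ℝ | aSeq lam (n - 1) = 0}.ncard = n - 1 ∧
    (⨆ i, fam16 n i) = (DLA n).toSubmodule ∧
    (∀ i, Disjoint (fam16 n i) (⨆ j, ⨆ (_ : j ≠ i), fam16 n j)) ∧
    Module.finrank ℝ (centerSub n) = 2 ∧
    (∀ lam : {lam : ℝ // aSeq lam (n - 1) = 0},
      Module.finrank ℝ (Ideal n lam.1) = 3 ∧
      (∀ A ∈ DLA n, ∀ B ∈ Ideal n lam.1, ⁅A, B⁆ ∈ Ideal n lam.1) ∧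
      ∃ f : M n →ₗ[ℝ] Matrix (Fin 2) (Fin 2) ℂ,
        Set.BijOn f (Ideal n lam.1 : Set (M n))
          {A : Matrix (Fin 2) (Fin 2) ℂ | Aᴴ = -A ∧ Matrix.trace A = 0} ∧
        ∀ A ∈ Ideal n lam.1, ∀ B ∈ Ideal n lam.1, f ⁅A, B⁆ = ⁅f A, f B⁆) := by
  have ho := ons (chain hn) (by omega)
  have hp : 0 < n := by omega
  have hD := DLA_eq (n := n) (by omega)
  have hidx : ∀ lam : {lam : ℝ // aSeq lam (n - 1) = 0}, ∃ j : ℕ, 1 ≤ j ∧ j < n ∧ lam.1 = rt n j ∧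
      Ideal n lam.1 = Ons.JJ n (oA n (ee n)) (oG n (ee n)) j ∧
      Trip n (Ons.cS n (oA n (ee n)) j) (Ons.sS n (oA n (ee n)) j) (Ons.sS n (oG n (ee n)) j) := by
    intro lam
    obtain ⟨j, h1, h2, h3⟩ := (root_iff n hn lam.1).mp lam.2
    obtain ⟨h4, h5⟩ := Ideal_eq hn h1 h2
    exact ⟨j, h1, h2, h3, h3 ▸ h4, ho.trip hp (by omega) (by omega) h5⟩
  have hW : Ons.KK n (oA n (ee n)) ⊔ ⨆ lam : {lam : ℝ // aSeq lam (n - 1) = 0}, Ideal n lam.1 =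
      (DLA n).toSubmodule := by
    rw [hD]
    apply le_antisymm
    · refine sup_le ho.KK_le (iSup_le fun lam => ?_)
      obtain ⟨j, h1, h2, h3, h4, h5⟩ := hidx lam
      rw [h4]; exact ho.JJ_le j
    · refine ho.DD_le hp _ le_sup_left fun j h1 h2 => ?_
      obtain ⟨k, rfl⟩ : ∃ k : ℕ, j = k := ⟨j.toNat, by omega⟩
      obtain ⟨h4, -⟩ := Ideal_eq (n := n) hn (j := k) (by omega) (by omega)
      rw [← h4]
      exact (le_iSup (fun lam : {lam : ℝ // aSeq lam (n - 1) = 0} => Ideal n lam.1)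
        ⟨rt n k, (root_iff n hn _).mpr ⟨k, by omega, by omega, rfl⟩⟩).trans le_sup_right
  have hK : ∀ k ∈ Ons.KK n (oA n (ee n)), ∀ x ∈ DLA n, ⁅k, x⁆ = 0 := by
    rw [hD]; exact ho.KK_central hp
  have hIJ : ∀ l l' : {lam : ℝ // aSeq lam (n - 1) = 0}, l ≠ l' → ∀ x ∈ Ideal n l.1, ∀ y ∈ Ideal n l'.1,
      ⁅x, y⁆ = 0 := by
    intro l l' hll
    obtain ⟨j, h1, h2, h3, h4, h5⟩ := hidx l
    obtain ⟨j', h1', h2', h3', h4', h5'⟩ := hidx l'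
    rw [h4, h4']
    refine ho.JJ_comm hp (by omega) (by omega) (by omega) (by omega) ?_
    intro hjj
    apply hll
    apply Subtype.ext
    rw [h3, h3']
    congr 1; omega
  have hZ : ∀ l : {lam : ℝ // aSeq lam (n - 1) = 0}, ∀ x ∈ Ideal n l.1, (∀ y ∈ Ideal n l.1, ⁅x, y⁆ = 0) → x = 0 := by
    intro l
    obtain ⟨j, h1, h2, h3, h4, h5⟩ := hidx l
    rw [h4]
    exact h5.centerless
  have hC : centerSub n = Ons.KK n (oA n (ee n)) := by
    apply le_antisymm
    · rintro z ⟨hz1, hz2⟩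
      exact abs_center hW hK hIJ hZ z hz1 hz2
    · intro k hk
      exact ⟨by rw [hD]; exact ho.KK_le hk, hK k hk⟩
  refine ⟨root_card n hn, ?_, ?_, ?_, ?_⟩
  · rw [iSup_option, ← hW]
    simp only [fam16, hC]
  · exact abs_indep hW hK hIJ hZ (fam16 n) hC (fun _ => rfl)
  · rw [hC]; exact KK_rank hn
  · intro lam
    obtain ⟨j, h1, h2, h3, h4, h5⟩ := hidx lam
    rw [h4]
    refine ⟨h5.rank, ?_, h5.exists_su⟩
    rw [hD]
    exact ho.JJ_ideal hp j
end final


/-- For every `n ≥ 3`, the dynamical Lie algebra is the internal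
direct sum of its two-dimensional center and of the subspaces `I_λ̄`, where `λ̄` runs
over the `n-1` distinct real roots of `a_{n-1}`; each `I_λ̄` is a three-dimensional
Lie ideal of `ℒ`, isomorphic as a real Lie algebra to `su(2)` (the traceless
skew-Hermitian `2 × 2` complex matrices). -/
theorem stmt16 (n : ℕ) (hn : 3 ≤ n) :
    {lam : ℝ | aSeq lam (n - 1) = 0}.ncard = n - 1 ∧
    (⨆ i, fam16 n i) = (DLA n).toSubmodule ∧
    (∀ i, Disjoint (fam16 n i) (⨆ j, ⨆ (_ : j ≠ i), fam16 n j)) ∧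
    Module.finrank ℝ (centerSub n) = 2 ∧
    (∀ lam : {lam : ℝ // aSeq lam (n - 1) = 0},
      Module.finrank ℝ (Ideal n lam.1) = 3 ∧
      (∀ A ∈ DLA n, ∀ B ∈ Ideal n lam.1, ⁅A, B⁆ ∈ Ideal n lam.1) ∧
      ∃ f : M n →ₗ[ℝ] Matrix (Fin 2) (Fin 2) ℂ,
        Set.BijOn f (Ideal n lam.1 : Set (M n))
          {A : Matrix (Fin 2) (Fin 2) ℂ | Aᴴ = -A ∧ Matrix.trace A = 0} ∧
        ∀ A ∈ Ideal n lam.1, ∀ B ∈ Ideal n lam.1, f ⁅A, B⁆ = ⁅f A, f B⁆) := by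
  exact main hn

end
end Ising
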